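/- arXiv:cs/0409057 — 11 statements merged into one kernel-verified Lean document; each statement's English description precedes it below -/
import Mathlib

section
/- Let (P,d) be a finite metric space with doubling constant λ ≥ 1 and let m be a positive integer with m ≤ |P|. Let r_opt(P,m) denote the smallest radius r ≥ 0 such that |B(p,r)| ≥ m for some p ∈ P. Then for every real r with 0 < r ≤ 2·r_opt(P,m) and every x ∈ P, the ball B(x,2r) contains at most λ³·m points of P. -/
/-- A finite metric space `P` has doubling constant `lam` if for every `x ∈ P` and `r > 0`
there are at most `lam` points whose closed balls of radius `r/2` cover the closed ball
`B(x,r)`. -/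
def IsDoubling (P : Type*) [MetricSpace P] (lam : ℝ) : Prop :=
  ∀ (x : P) (r : ℝ), 0 < r → ∃ s : Finset P, (s.card : ℝ) ≤ lam ∧
    ∀ y : P, dist x y ≤ r → ∃ z ∈ s, dist z y ≤ r / 2

/-- If every ball of radius `R / 2` has at most `C` points, then every ball of radius `R` has at
most `lam * C` points. -/
theorem IsDoubling.card_closedBall_le {P : Type*} [MetricSpace P] [Fintype P] {lam : ℝ}
    (h : IsDoubling P lam) {R C : ℝ} (hR : 0 < R) (hC : 0 ≤ C)
    (hball : ∀ z : P, ((Finset.univ.filter (fun y => dist z y ≤ R / 2)).card : ℝ) ≤ C) (x : P) :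
    ((Finset.univ.filter (fun y => dist x y ≤ R)).card : ℝ) ≤ lam * C := by
  classical
  obtain ⟨s, hs, hcover⟩ := h x R hR
  have hsub : Finset.univ.filter (fun y => dist x y ≤ R) ⊆
      s.biUnion fun z => Finset.univ.filter (fun y => dist z y ≤ R / 2) := by
    intro y hy
    simpa using hcover y (by simpa using hy)
  calc ((Finset.univ.filter (fun y => dist x y ≤ R)).card : ℝ)
      ≤ ∑ z ∈ s, ((Finset.univ.filter (fun y => dist z y ≤ R / 2)).card : ℝ) := by
        exact_mod_cast (Finset.card_le_card hsub).trans Finset.card_biUnion_le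
    _ ≤ s.card * C := by
        simpa using Finset.sum_le_sum fun z (_ : z ∈ s) => hball z
    _ ≤ lam * C := by gcongr

theorem stmt0 {P : Type*} [MetricSpace P] [Fintype P]
    (lam : ℝ) (hlam : 1 ≤ lam) (hdbl : IsDoubling P lam)
    (m : ℕ) (hm : 0 < m) (hmP : m ≤ Fintype.card P)
    (rOpt : ℝ) (hrOpt0 : 0 ≤ rOpt)
    (hrOptBall : ∃ p : P, m ≤ (Finset.univ.filter (fun y => dist p y ≤ rOpt)).card)
    (hrOptMin : ∀ r' : ℝ, 0 ≤ r' →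
      (∃ p : P, m ≤ (Finset.univ.filter (fun y => dist p y ≤ r')).card) → rOpt ≤ r')
    (r : ℝ) (hr : 0 < r) (hr2 : r ≤ 2 * rOpt) (x : P) :
    ((Finset.univ.filter (fun y => dist x y ≤ 2 * r)).card : ℝ) ≤ lam ^ 3 * m := by
  have hlam0 : 0 ≤ lam := zero_le_one.trans hlam
  have hsmall (z : P) :
      ((Finset.univ.filter (fun y => dist z y ≤ 2 * r / 2 / 2 / 2)).card : ℝ) ≤ m := by
    by_contra! hlt
    have := hrOptMin (2 * r / 2 / 2 / 2) (by positivity) ⟨z, by exact_mod_cast hlt.le⟩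
    linarith
  calc ((Finset.univ.filter (fun y => dist x y ≤ 2 * r)).card : ℝ)
      ≤ lam * (lam * (lam * m)) :=
        hdbl.card_closedBall_le (by positivity) (by positivity)
          (hdbl.card_closedBall_le (by positivity) (by positivity)
            (hdbl.card_closedBall_le (by positivity) (by positivity) hsmall)) x
    _ = lam ^ 3 * m := by ring
end

section
/- Let (P,d) be a finite metric space with |P| = n ≥ 2. Then there exists an ultrametric ρ on P such that d(x,y) ≤ ρ(x,y) ≤ (n−1)·d(x,y) for all x, y ∈ P. -/
/-- The graph joining distinct points of a metric space at distance at most `r`. -/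
def proximityGraph (P : Type*) [MetricSpace P] (r : ℝ) : SimpleGraph P where
  Adj x y := x ≠ y ∧ dist x y ≤ r
  symm := ⟨fun x y h => ⟨h.1.symm, by rw [dist_comm]; exact h.2⟩⟩
  loopless := ⟨fun _ h => h.1 rfl⟩

theorem proximityGraph_mono (P : Type*) [MetricSpace P] : Monotone (proximityGraph P) :=
  fun _ _ hrs _ _ h => ⟨h.1, h.2.trans hrs⟩

/-- The nonnegative scales at which `x` and `y` are joined by a chain. -/
def linkingScales {P : Type*} [MetricSpace P] (x y : P) : Set ℝ :=
  {r | 0 ≤ r ∧ (proximityGraph P r).Reachable x y}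

theorem dist_mem_linkingScales {P : Type*} [MetricSpace P] (x y : P) :
    dist x y ∈ linkingScales x y := by
  refine ⟨dist_nonneg, ?_⟩
  by_cases h : x = y
  · subst h
    exact SimpleGraph.Reachable.refl _
  · exact SimpleGraph.Adj.reachable (G := proximityGraph P (dist x y)) ⟨h, le_rfl⟩

theorem bddBelow_linkingScales {P : Type*} [MetricSpace P] (x y : P) :
    BddBelow (linkingScales x y) :=
  ⟨0, fun _ h => h.1⟩

theorem linkingScales_comm {P : Type*} [MetricSpace P] (x y : P) :
    linkingScales x y = linkingScales y x := by
  ext r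
  exact and_congr_right fun _ => SimpleGraph.reachable_comm

theorem sInf_linkingScales_le_max {P : Type*} [MetricSpace P] (x y z : P) :
    sInf (linkingScales x z) ≤ max (sInf (linkingScales x y)) (sInf (linkingScales y z)) := by
  refine le_of_forall_gt_imp_ge_of_dense fun t ht => ?_
  obtain ⟨hxy, hyz⟩ := max_lt_iff.mp ht
  obtain ⟨r, hr, hrt⟩ := exists_lt_of_csInf_lt ⟨_, dist_mem_linkingScales x y⟩ hxy
  obtain ⟨s, hs, hst⟩ := exists_lt_of_csInf_lt ⟨_, dist_mem_linkingScales y z⟩ hyz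
  exact csInf_le (bddBelow_linkingScales x z) ⟨hr.1.trans hrt.le,
    (hr.2.mono (proximityGraph_mono P hrt.le)).trans (hs.2.mono (proximityGraph_mono P hst.le))⟩

theorem dist_le_length_mul {P : Type*} [MetricSpace P] {r : ℝ} {x y : P}
    (p : (proximityGraph P r).Walk x y) : dist x y ≤ p.length * r := by
  induction p with
  | nil => simp
  | @cons u v w h p ih =>
    have := dist_triangle u v w
    have := h.2
    rw [SimpleGraph.Walk.length_cons]
    push_cast
    linarith

theorem dist_le_card_sub_one_mul {P : Type*} [MetricSpace P] [Fintype P] {r : ℝ} {x y : P}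
    (h : r ∈ linkingScales x y) : dist x y ≤ ((Fintype.card P : ℝ) - 1) * r := by
  obtain ⟨hr, hxy⟩ := h
  obtain ⟨p, hp⟩ := hxy.exists_isPath
  refine (dist_le_length_mul p).trans (mul_le_mul_of_nonneg_right ?_ hr)
  have : (p.length : ℝ) + 1 ≤ Fintype.card P := by exact_mod_cast hp.length_lt
  linarith

theorem stmt4 {P : Type*} [MetricSpace P] [Fintype P] (hn : 2 ≤ Fintype.card P) :
    ∃ ρ : P → P → ℝ,
      (∀ x y, ρ x y = ρ y x) ∧
      (∀ x y, ρ x y = 0 ↔ x = y) ∧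
      (∀ x y, 0 ≤ ρ x y) ∧
      (∀ x y z, ρ x z ≤ max (ρ x y) (ρ y z)) ∧
      (∀ x y, dist x y ≤ ρ x y ∧ ρ x y ≤ ((Fintype.card P : ℝ) - 1) * dist x y) := by
  have hcard : (0 : ℝ) < (Fintype.card P : ℝ) - 1 := by
    have : (2 : ℝ) ≤ Fintype.card P := by exact_mod_cast hn
    linarith
  have lower (x y : P) :
      dist x y ≤ ((Fintype.card P : ℝ) - 1) * sInf (linkingScales x y) := by
    rw [← div_le_iff₀' hcard]
    exact le_csInf ⟨_, dist_mem_linkingScales x y⟩ fun r hr =>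
      (div_le_iff₀' hcard).mpr (dist_le_card_sub_one_mul hr)
  have upper (x y : P) : ((Fintype.card P : ℝ) - 1) * sInf (linkingScales x y) ≤
      ((Fintype.card P : ℝ) - 1) * dist x y :=
    mul_le_mul_of_nonneg_left
      (csInf_le (bddBelow_linkingScales x y) (dist_mem_linkingScales x y)) hcard.le
  refine ⟨fun x y => ((Fintype.card P : ℝ) - 1) * sInf (linkingScales x y),
    fun x y => by simp only [linkingScales_comm x y], fun x y => ⟨fun h => ?_, fun h => ?_⟩,
    fun x y => dist_nonneg.trans (lower x y), fun x y z => ?_,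
    fun x y => ⟨lower x y, upper x y⟩⟩
  · exact dist_le_zero.mp ((lower x y).trans h.le)
  · subst h
    exact le_antisymm ((upper x x).trans (by simp)) (dist_nonneg.trans (lower x x))
  · rw [← mul_max_of_nonneg _ _ hcard.le]
    exact mul_le_mul_of_nonneg_left (sInf_linkingScales_le_max x y z) hcard.le
end

section
/- Let (P,d) be a finite metric space and let T be a net-tree for P with parameter τ = 11. Then for every integer l: (i) any two distinct points p, q ∈ N_C(l) satisfy d(p,q) ≥ τ^{l−1}/4; and (ii) P ⊆ ⋃_{p ∈ N_C(l)} B(p, 4·τ^{l}). -/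
/-- `(11 : ℝ)` raised to a level in `ℤ ∪ {-∞}`, with the convention `11 ^ (-∞) = 0`. -/
noncomputable def tpow (l : WithBot ℤ) : ℝ :=
  WithBot.recBotCoe 0 (fun k : ℤ => (11 : ℝ) ^ k) l

/-- The net `N_C(l)` extracted from a net-tree: the representatives of non-root vertices `u`
with `ℓ(u) < l ≤ ℓ(parent u)`, together with the representative of the root if `ℓ(root) < l`. -/
def netNC {P V : Type*} (rt : V) (parent : V → V) (rep : V → P)
    (lev : V → WithBot ℤ) (l : ℤ) : Set P :=
  {q | (∃ u : V, u ≠ rt ∧ lev u < (l : WithBot ℤ) ∧ (l : WithBot ℤ) ≤ lev (parent u) ∧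
          rep u = q) ∨
       (lev rt < (l : WithBot ℤ) ∧ rep rt = q)}

theorem tpow_le_zpow_of_lt {m : WithBot ℤ} {l : ℤ} (h : m < (l : WithBot ℤ)) :
    tpow m ≤ (11 : ℝ) ^ l := by
  induction m with
  | bot =>
    change (0 : ℝ) ≤ _
    positivity
  | coe k =>
    change (11 : ℝ) ^ k ≤ _
    exact zpow_le_zpow_right₀ (by norm_num) (WithBot.coe_lt_coe.mp h).le

theorem le_apply_iterate {V α : Type*} [Preorder α] {parent : V → V} {lev : V → α}
    (h : ∀ v, lev v ≤ lev (parent v)) (k : ℕ) (v : V) : lev v ≤ lev (parent^[k] v) := by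
  induction k with
  | zero => exact le_rfl
  | succ k ih =>
    rw [Function.iterate_succ_apply']
    exact ih.trans (h _)

/-- A vertex at which the levels cross `l` is the only such vertex among its ancestors. -/
theorem iterate_eq_self_of_crossing {V α : Type*} [Preorder α] {rt : V} {parent : V → V}
    {lev : V → α} (hrt : parent rt = rt) (h : ∀ v, lev v ≤ lev (parent v)) {l : α} {u : V}
    (hu : u = rt ∨ l ≤ lev (parent u)) {k : ℕ} (hk : lev (parent^[k] u) < l) :
    parent^[k] u = u := by
  rcases hu with rfl | hu
  · exact Function.iterate_fixed hrt k
  · cases k with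
    | zero => rfl
    | succ k =>
      rw [Function.iterate_succ_apply] at hk
      exact absurd ((hu.trans (le_apply_iterate h k _)).trans_lt hk) (lt_irrefl _)

/-- On each path to the root, the levels cross `l` at no more than one vertex. -/
theorem eq_of_crossing {V α : Type*} [Preorder α] {rt : V} {parent : V → V}
    {lev : V → α} (hrt : parent rt = rt) (h : ∀ v, lev v ≤ lev (parent v)) {l : α} {x : V}
    {i j : ℕ} (hi : parent^[i] x = rt ∨ l ≤ lev (parent (parent^[i] x)))
    (hj : parent^[j] x = rt ∨ l ≤ lev (parent (parent^[j] x)))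
    (hi' : lev (parent^[i] x) < l) (hj' : lev (parent^[j] x) < l) :
    parent^[i] x = parent^[j] x := by
  rcases le_total i j with hij | hij
  · obtain ⟨m, rfl⟩ := Nat.exists_eq_add_of_le' hij
    rw [Function.iterate_add_apply] at hj' ⊢
    exact (iterate_eq_self_of_crossing hrt h hi hj').symm
  · obtain ⟨m, rfl⟩ := Nat.exists_eq_add_of_le' hij
    rw [Function.iterate_add_apply] at hi' ⊢
    exact iterate_eq_self_of_crossing hrt h hj hi'

/-- On each path to the root starting below `l`, the levels cross `l` at some vertex. -/
theorem exists_crossing {V α : Type*} [LinearOrder α] {rt : V} {parent : V → V}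
    {lev : V → α} {l : α} {x : V} (hx : lev x < l) (hreach : ∃ k : ℕ, parent^[k] x = rt) :
    ∃ k : ℕ, lev (parent^[k] x) < l ∧
      (parent^[k] x = rt ∨ l ≤ lev (parent (parent^[k] x))) := by
  classical
  have hex : ∃ k : ℕ, parent^[k] x = rt ∨ l ≤ lev (parent (parent^[k] x)) :=
    hreach.imp fun _ => Or.inl
  refine ⟨Nat.find hex, ?_, Nat.find_spec hex⟩
  rcases hk : Nat.find hex with _ | k
  · exact hx
  · have hmin := Nat.find_min hex (m := k) (by omega)
    push Not at hmin
    rw [Function.iterate_succ_apply']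
    exact hmin.2

theorem mem_netNC_iff {P V : Type*} {rt : V} {parent : V → V} {rep : V → P}
    {lev : V → WithBot ℤ} (hrt : parent rt = rt) {l : ℤ} {q : P} :
    q ∈ netNC rt parent rep lev l ↔ ∃ u : V, lev u < (l : WithBot ℤ) ∧
      (u = rt ∨ (l : WithBot ℤ) ≤ lev (parent u)) ∧ rep u = q := by
  constructor
  · rintro (⟨u, -, h1, h2, h3⟩ | ⟨h1, h2⟩)
    · exact ⟨u, h1, Or.inr h2, h3⟩
    · exact ⟨rt, h1, Or.inl rfl, h2⟩
  · rintro ⟨u, h1, h2, h3⟩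
    by_cases hu : u = rt
    · subst hu
      exact Or.inr ⟨h1, h3⟩
    · exact Or.inl ⟨u, hu, h1, h2.resolve_left hu, h3⟩

theorem stmt5 {P V : Type*} [MetricSpace P] [Fintype P] [Fintype V]
    -- the data of a net-tree with parameter τ = 11:
    (rt : V) (parent : V → V) (leaf : P → V) (rep : V → P) (lev : V → WithBot ℤ)
    (Pv : V → Set P)
    -- `V` is a rooted tree with root `rt` whose set of leaves is exactly `P`:
    (hparent_rt : parent rt = rt)
    (hreach : ∀ v : V, ∃ k : ℕ, parent^[k] v = rt)
    (hleaf_inj : Function.Injective leaf)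
    (hleaf_iff : ∀ v : V, lev v = ⊥ ↔ ∃ p : P, leaf p = v)
    (hnochild : ∀ u v : V, lev v = ⊥ → parent u = v → u = v)
    -- levels are strictly increasing towards the root, `ℓ(rt) ∈ ℤ`:
    (hlev_lt : ∀ v : V, v ≠ rt → lev v < lev (parent v))
    (hrt : lev rt ≠ ⊥)
    -- `Pv v` is the set of leaves of the subtree rooted at `v`, and `rep v ∈ Pv v`:
    (hPv : ∀ v : V, Pv v = {p : P | ∃ k : ℕ, parent^[k] (leaf p) = v})
    (hrep_mem : ∀ v : V, rep v ∈ Pv v)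
    -- covering property:
    (hcover : ∀ v : V, ∀ q ∈ Pv v,
      dist (rep v) q ≤ (2 * 11 / (11 - 1) : ℝ) * tpow (lev v))
    -- packing property:
    (hpack : ∀ v : V, v ≠ rt → ∀ lp : ℤ, lev (parent v) = (lp : WithBot ℤ) →
      ∀ q : P, dist (rep v) q ≤ ((11 - 5) / (2 * (11 - 1)) : ℝ) * (11 : ℝ) ^ (lp - 1) →
        q ∈ Pv v)
    (l : ℤ) :
    (∀ p ∈ netNC rt parent rep lev l, ∀ q ∈ netNC rt parent rep lev l,
      p ≠ q → (11 : ℝ) ^ (l - 1) / 4 ≤ dist p q) ∧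
    (∀ x : P, ∃ q ∈ netNC rt parent rep lev l, dist q x ≤ 4 * (11 : ℝ) ^ l) := by
  have hmono : ∀ v, lev v ≤ lev (parent v) := fun v => by
    by_cases hv : v = rt
    · rw [hv, hparent_rt]
    · exact (hlev_lt v hv).le
  constructor
  · intro p hp q hq hpq
    obtain ⟨u, hu, hu', rfl⟩ := (mem_netNC_iff hparent_rt).mp hp
    obtain ⟨w, hw, hw', rfl⟩ := (mem_netNC_iff hparent_rt).mp hq
    by_contra! hd
    have hmem : rep w ∈ Pv u := by
      by_cases hurt : u = rt
      · rw [hurt, hPv]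
        exact hreach _
      · have hul := hu'.resolve_left hurt
        obtain ⟨m, hm⟩ := WithBot.ne_bot_iff_exists.mp (ne_bot_of_le_ne_bot WithBot.coe_ne_bot hul)
        rw [← hm, WithBot.coe_le_coe] at hul
        refine hpack u hurt m hm.symm _ (hd.le.trans ?_)
        have hpow : (11 : ℝ) ^ (l - 1) ≤ 11 ^ (m - 1) :=
          zpow_le_zpow_right₀ (by norm_num) (by omega)
        have hpos : (0 : ℝ) < 11 ^ (l - 1) := by positivity
        linarith
    have hmem' := hrep_mem w
    rw [hPv] at hmem hmem'
    obtain ⟨i, rfl⟩ := hmem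
    obtain ⟨j, hj⟩ := hmem'
    refine hpq (congrArg rep ?_)
    rw [← hj] at hw hw'
    exact (eq_of_crossing hparent_rt hmono hu' hw' hu hw).trans hj
  · intro x
    have hx : lev (leaf x) < (l : WithBot ℤ) := by
      rw [(hleaf_iff _).mpr ⟨x, rfl⟩]
      exact WithBot.bot_lt_coe l
    obtain ⟨k, hk, hk'⟩ := exists_crossing hx (hreach _)
    refine ⟨_, (mem_netNC_iff hparent_rt).mpr ⟨_, hk, hk', rfl⟩, ?_⟩
    have hc := hcover (parent^[k] (leaf x)) x (by rw [hPv]; exact ⟨k, rfl⟩)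
    have ht := tpow_le_zpow_of_lt hk
    have hpos : (0 : ℝ) < 11 ^ l := by positivity
    linarith
end

section
/- There is a universal constant c > 0 such that the following holds. Let (P,d) be a finite metric space with doubling constant λ ≥ 2 and |P| = n ≥ 2, and let 0 < ε ≤ 1. Then there exists a finite collection of quadruples (A_i, B_i, a_i, b_i), 1 ≤ i ≤ s, with A_i, B_i nonempty subsets of P, a_i ∈ A_i, b_i ∈ B_i, such that: (1) A_i ∩ B_i = ∅ for every i; (2) for every pair of distinct points x, y ∈ P there exists i with (x ∈ A_i and y ∈ B_i) or (x ∈ B_i and y ∈ A_i); (3) d(A_i, B_i) ≥ ε^{−1}·max(diam A_i, diam B_i) for every i; (4) max(diam A_i, diam B_i) ≤ ε·d(a_i, b_i) for every i; and (5) s ≤ n·(2/ε)^{c·log₂ λ}. -/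
open Finset in
/-- One step of farthest-first traversal: a partial radius assignment `ρ` on `S` extends to a
farthest point from `S`. -/
theorem exists_farthest_insert {P : Type*} [MetricSpace P] [Fintype P] [DecidableEq P] {D : ℝ}
    {S : Finset P} (hne : S.Nonempty) (hS : S ≠ univ) {ρ : P → ℝ}
    (hsep : ∀ p ∈ S, ∀ q ∈ S, p ≠ q → min (ρ p) (ρ q) ≤ dist p q)
    (hcov : ∀ t < D, (∀ x, ∃ p ∈ S, dist x p ≤ t) → ∀ x, ∃ p ∈ S, t < ρ p ∧ dist x p ≤ t)
    (hrad : ∀ p ∈ S, ∀ x, ∃ q ∈ S, dist x q ≤ ρ p) :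
    ∃ q ∉ S, ∃ σ : P → ℝ,
      (∀ p ∈ insert q S, ∀ p' ∈ insert q S, p ≠ p' → min (σ p) (σ p') ≤ dist p p') ∧
      (∀ t < D, (∀ x, ∃ p ∈ insert q S, dist x p ≤ t) →
        ∀ x, ∃ p ∈ insert q S, t < σ p ∧ dist x p ≤ t) ∧
      (∀ p ∈ insert q S, ∀ x, ∃ p' ∈ insert q S, dist x p' ≤ σ p) := by
  have hnear : ∀ x : P, ∃ p ∈ S, ∀ p' ∈ S, dist x p ≤ dist x p' := fun x =>
    S.exists_min_image (fun p => dist x p) hne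
  choose f hfS hf using hnear
  obtain ⟨q, hqc, hq⟩ := Sᶜ.exists_max_image (fun x => dist x (f x))
    (by simpa [nonempty_iff_ne_empty] using hS)
  have hqS : q ∉ S := by simpa using hqc
  have hmax : ∀ x, dist x (f x) ≤ dist q (f q) := fun x => by
    by_cases hx : x ∈ S
    · exact (hf x x hx).trans (by simp)
    · exact hq x (by simpa using hx)
  have hne' : ∀ p ∈ S, p ≠ q := fun p hp h => hqS (h ▸ hp)
  have hle : ∀ p ∈ S, dist q (f q) ≤ ρ p := fun p hp => by
    obtain ⟨p', hp', h⟩ := hrad p hp q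
    exact (hf q p' hp').trans h
  refine ⟨q, hqS, Function.update ρ q (dist q (f q)), ?_, ?_, ?_⟩
  · intro p hp p' hp' hpp'
    rcases mem_insert.1 hp with rfl | hpS <;> rcases mem_insert.1 hp' with rfl | hpS'
    · exact absurd rfl hpp'
    · rw [Function.update_self]
      exact (min_le_left _ _).trans (hf _ _ hpS')
    · rw [Function.update_self, dist_comm p]
      exact (min_le_right _ _).trans (hf _ _ hpS)
    · rw [Function.update_of_ne (hne' p hpS), Function.update_of_ne (hne' p' hpS')]
      exact hsep p hpS p' hpS' hpp'
  · intro t ht hc x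
    rcases le_or_gt (dist q (f q)) t with h | h
    · obtain ⟨p, hp, h1, h2⟩ := hcov t ht (fun y => ⟨f y, hfS y, (hmax y).trans h⟩) x
      exact ⟨p, mem_insert_of_mem hp, by rwa [Function.update_of_ne (hne' p hp)], h2⟩
    · obtain ⟨p, hp, h2⟩ := hc x
      refine ⟨p, hp, ?_, h2⟩
      rcases mem_insert.1 hp with rfl | hp
      · rwa [Function.update_self]
      · rw [Function.update_of_ne (hne' p hp)]
        exact h.trans_le (hle p hp)
  · intro p hp x
    rcases mem_insert.1 hp with rfl | hp
    · exact ⟨f x, mem_insert_of_mem (hfS x), by rw [Function.update_self]; exact hmax x⟩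
    · obtain ⟨p', hp', h⟩ := hrad p hp x
      exact ⟨p', mem_insert_of_mem hp', by rwa [Function.update_of_ne (hne' p hp)]⟩

/-- Every finite metric space carries radii `ρ` whose superlevel sets `{ρ > t}` are
`t`-separated `t`-coverings, for every scale `t` below the diameter. -/
theorem exists_net_radius (P : Type*) [MetricSpace P] [Fintype P] :
    ∃ ρ : P → ℝ, (∀ p q, p ≠ q → min (ρ p) (ρ q) ≤ dist p q) ∧
      ∀ (x y : P) (t : ℝ), 0 ≤ t → t ≤ dist x y → ∀ z, ∃ p, t < ρ p ∧ dist z p ≤ t := by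
  classical
  rcases isEmpty_or_nonempty P with _ | ⟨⟨p₀⟩⟩
  · exact ⟨fun _ => 0, fun p => isEmptyElim p, fun p => isEmptyElim p⟩
  obtain ⟨D, hD⟩ : ∃ D : ℝ, ∀ x y : P, dist x y < D :=
    ⟨Metric.diam (Set.univ : Set P) + 1, fun x y => lt_add_of_le_of_pos
      (Metric.dist_le_diam_of_mem Set.finite_univ.isBounded trivial trivial) one_pos⟩
  have key : ∀ k < Fintype.card P, ∃ S : Finset P, S.card = k + 1 ∧ ∃ ρ : P → ℝ,
      (∀ p ∈ S, ∀ q ∈ S, p ≠ q → min (ρ p) (ρ q) ≤ dist p q) ∧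
      (∀ t < D, (∀ x, ∃ p ∈ S, dist x p ≤ t) → ∀ x, ∃ p ∈ S, t < ρ p ∧ dist x p ≤ t) ∧
      (∀ p ∈ S, ∀ x, ∃ q ∈ S, dist x q ≤ ρ p) := by
    intro k
    induction k with
    | zero =>
      intro _
      refine ⟨{p₀}, by simp, fun _ => D, by simp, ?_, ?_⟩
      · intro t ht h x
        obtain ⟨p, hp, hx⟩ := h x
        exact ⟨p, hp, ht, hx⟩
      · exact fun p _ x => ⟨p₀, by simp, (hD _ _).le⟩
    | succ k ih =>
      intro hk
      obtain ⟨S, hcard, ρ, h1, h2, h3⟩ := ih (by omega)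
      obtain ⟨q, hq, σ, hσ⟩ := exists_farthest_insert (Finset.card_pos.1 (by omega))
        (fun h => by rw [h, Finset.card_univ] at hcard; omega) h1 h2 h3
      exact ⟨insert q S, by rw [Finset.card_insert_of_notMem hq, hcard], σ, hσ⟩
  have hpos : 0 < Fintype.card P := Fintype.card_pos_iff.2 ⟨p₀⟩
  obtain ⟨S, hcard, ρ, h1, h2, -⟩ := key (Fintype.card P - 1) (by omega)
  obtain rfl : S = Finset.univ := (Finset.card_eq_iff_eq_univ S).1 (by omega)
  refine ⟨ρ, fun p q => h1 p (Finset.mem_univ p) q (Finset.mem_univ q), fun x y t h0 ht z => ?_⟩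
  obtain ⟨p, -, hp⟩ := h2 t (ht.trans_lt (hD x y))
    (fun w => ⟨w, Finset.mem_univ w, by simpa using h0⟩) z
  exact ⟨p, hp⟩

theorem IsDoubling.exists_cover_pow {P : Type*} [MetricSpace P] {lam : ℝ} (h : IsDoubling P lam)
    (hlam : 0 ≤ lam) (k : ℕ) (x : P) {r : ℝ} (hr : 0 < r) :
    ∃ s : Finset P, (s.card : ℝ) ≤ lam ^ k ∧ ∀ y, dist x y ≤ r → ∃ z ∈ s, dist z y ≤ r / 2 ^ k := by
  classical
  induction k with
  | zero => exact ⟨{x}, by simp, fun y hy => ⟨x, by simp, by simpa using hy⟩⟩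
  | succ k ih =>
    obtain ⟨s, hs, hcov⟩ := ih
    choose f hf hfcov using fun z : P => h z (r / 2 ^ k) (by positivity)
    refine ⟨s.biUnion f, ?_, fun y hy => ?_⟩
    · calc ((s.biUnion f).card : ℝ) ≤ ∑ z ∈ s, ((f z).card : ℝ) := by
            exact_mod_cast Finset.card_biUnion_le
        _ ≤ ∑ _z ∈ s, lam := Finset.sum_le_sum fun z _ => hf z
        _ = s.card * lam := by simp
        _ ≤ lam ^ (k + 1) := by rw [pow_succ]; gcongr
    · obtain ⟨z, hz, hzy⟩ := hcov y hy
      obtain ⟨w, hw, hwy⟩ := hfcov z y hzy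
      exact ⟨w, Finset.mem_biUnion.2 ⟨z, hz, hw⟩, by rwa [pow_succ, ← div_div]⟩

/-- Packing bound: separated subsets of a ball in a doubling space are small. -/
theorem IsDoubling.card_le_of_separated {P : Type*} [MetricSpace P] {lam : ℝ}
    (h : IsDoubling P lam) (hlam : 0 ≤ lam) {k : ℕ} {x : P} {R r : ℝ} (hR : 0 < R)
    (hk : 2 * R < r * 2 ^ k) {T : Finset P} (hT : ∀ p ∈ T, dist x p ≤ R)
    (hsep : ∀ p ∈ T, ∀ q ∈ T, p ≠ q → r ≤ dist p q) : (T.card : ℝ) ≤ lam ^ k := by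
  obtain ⟨s, hs, hcov⟩ := h.exists_cover_pow hlam k x hR
  choose! f hfs hf using fun p (hp : p ∈ T) => hcov p (hT p hp)
  refine le_trans ?_ hs
  exact_mod_cast Finset.card_le_card_of_injOn f hfs fun p hp q hq hpq => by
    by_contra hne
    have h1 := hsep p hp q hq hne
    have h2 := hf p hp
    have h3 := hf q hq
    rw [← hpq] at h3
    have h4 : 2 * (R / 2 ^ k) < r := by
      rw [← mul_div_assoc, div_lt_iff₀ (by positivity)]
      exact hk
    linarith [dist_triangle_left p q (f p)]

theorem exists_two_pow_near_and_pow_le {lam ε : ℝ} (hlam : 2 ≤ lam) (hε : 0 < ε) (hε1 : ε ≤ 1) :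
    ∃ k : ℕ, 32 / ε < 2 ^ k ∧ lam ^ k ≤ (2 / ε) ^ (6 * Real.logb 2 lam) := by
  obtain ⟨m, hm, hm'⟩ := exists_nat_pow_near (x := 32 / ε) (y := (2 : ℝ))
    ((one_le_div hε).2 (by linarith)) one_lt_two
  refine ⟨m + 1, hm', ?_⟩
  have hlog : 0 ≤ Real.logb 2 lam := Real.logb_nonneg one_lt_two (by linarith)
  have h2 : 2 ≤ 2 / ε := (le_div_iff₀ hε).2 (by linarith)
  have hpow : (2 : ℝ) ^ (m + 1) ≤ (2 / ε) ^ 6 := by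
    calc (2 : ℝ) ^ (m + 1) = 2 ^ m * 2 := pow_succ _ _
      _ ≤ 32 / ε * 2 := by gcongr
      _ = 2 ^ 5 * (2 / ε) := by ring
      _ ≤ (2 / ε) ^ 5 * (2 / ε) := by gcongr
      _ = (2 / ε) ^ 6 := by ring
  calc lam ^ (m + 1) = ((2 : ℝ) ^ Real.logb 2 lam) ^ (m + 1) := by
        rw [Real.rpow_logb two_pos (by norm_num) (by linarith)]
    _ = ((2 : ℝ) ^ (m + 1)) ^ Real.logb 2 lam := by
        rw [← Real.rpow_natCast, ← Real.rpow_natCast, ← Real.rpow_mul two_pos.le,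
          ← Real.rpow_mul two_pos.le, mul_comm]
    _ ≤ ((2 / ε) ^ 6) ^ Real.logb 2 lam := Real.rpow_le_rpow (by positivity) hpow hlog
    _ = (2 / ε) ^ (6 * Real.logb 2 lam) := by
        rw [Real.rpow_mul (by positivity), ← Real.rpow_natCast]; norm_num

theorem diam_filter_dist_le {P : Type*} [MetricSpace P] [Fintype P] (p : P) {r : ℝ} (hr : 0 ≤ r)
    [DecidablePred fun x : P => dist x p ≤ r] :
    Metric.diam ((Finset.univ.filter fun x : P => dist x p ≤ r : Finset P) : Set P) ≤ 2 * r :=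
  Metric.diam_le_of_forall_dist_le (by positivity) fun x hx y hy => by
    simp only [Finset.coe_filter, Finset.mem_univ, true_and, Set.mem_ofPred_eq] at hx hy
    linarith [dist_triangle_right x y p]

theorem stmt6 :
    ∃ c : ℝ, 0 < c ∧
      ∀ (P : Type) [MetricSpace P] [Fintype P] (lam : ℝ),
        IsDoubling P lam → 2 ≤ lam → 2 ≤ Fintype.card P →
        ∀ ε : ℝ, 0 < ε → ε ≤ 1 →
        ∃ (s : ℕ) (A B : Fin s → Finset P) (a b : Fin s → P),
          (∀ i, (A i).Nonempty) ∧ (∀ i, (B i).Nonempty) ∧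
          (∀ i, a i ∈ A i) ∧ (∀ i, b i ∈ B i) ∧
          (∀ i, Disjoint (A i) (B i)) ∧
          (∀ x y : P, x ≠ y → ∃ i, (x ∈ A i ∧ y ∈ B i) ∨ (x ∈ B i ∧ y ∈ A i)) ∧
          (∀ i, ∀ p ∈ A i, ∀ q ∈ B i,
            ε⁻¹ * max (Metric.diam ((A i : Finset P) : Set P))
                (Metric.diam ((B i : Finset P) : Set P)) ≤ dist p q) ∧
          (∀ i, max (Metric.diam ((A i : Finset P) : Set P))
              (Metric.diam ((B i : Finset P) : Set P)) ≤ ε * dist (a i) (b i)) ∧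
          (s : ℝ) ≤ (Fintype.card P : ℝ) * (2 / ε) ^ (c * Real.logb 2 lam) := by
  classical
  refine ⟨6, by norm_num, fun P _ _ lam hdoub hlam _ ε hε hε1 => ?_⟩
  obtain ⟨ρ, hsep, hcov⟩ := exists_net_radius P
  obtain ⟨k, hk, hkpow⟩ := exists_two_pow_near_and_pow_le hlam hε hε1
  let T : Finset (P × P) := Finset.univ.filter fun w =>
    w.1 ≠ w.2 ∧ ρ w.2 ≤ ρ w.1 ∧ ε * dist w.1 w.2 ≤ 16 * ρ w.2
  have hT : ∀ w ∈ T, w.1 ≠ w.2 := fun w hw => (Finset.mem_filter.1 hw).2.1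
  let e := T.equivFin.symm
  let C : P → P → Finset P := fun p q => Finset.univ.filter fun x => dist x p ≤ ε * dist p q / 4
  have hmem : ∀ p q x, x ∈ C p q ↔ dist x p ≤ ε * dist p q / 4 := fun p q x => by simp [C]
  have hself : ∀ p q, p ∈ C p q := fun p q => by rw [hmem, dist_self]; positivity
  have hle : ∀ p q : P, ε * dist p q ≤ dist p q := fun p q =>
    mul_le_of_le_one_left dist_nonneg hε1
  have hfar : ∀ p q : P, ∀ x ∈ C p q, ∀ y ∈ C q p, dist p q / 2 ≤ dist x y := by
    intro p q x hx y hy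
    rw [hmem] at hx hy
    rw [dist_comm q p] at hy
    linarith [hle p q, dist_triangle p x q, dist_triangle x y q, dist_comm p x]
  have hdiam : ∀ p q, Metric.diam (C p q : Set P) ≤ ε * dist p q / 2 := fun p q =>
    (diam_filter_dist_le p (by positivity)).trans (by linarith)
  have hmax : ∀ p q, max (Metric.diam (C p q : Set P)) (Metric.diam (C q p : Set P)) ≤
      ε * (dist p q / 2) := fun p q =>
    max_le ((hdiam p q).trans (by linarith)) ((hdiam q p).trans (by rw [dist_comm q p]; linarith))
  refine ⟨T.card, fun i => C (e i).1.1 (e i).1.2, fun i => C (e i).1.2 (e i).1.1,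
    fun i => (e i).1.1, fun i => (e i).1.2, fun i => ⟨_, hself _ _⟩, fun i => ⟨_, hself _ _⟩,
    fun i => hself _ _, fun i => hself _ _, fun i => ?_, fun x y hxy => ?_,
    fun i p hp q hq => ?_, fun i => (hmax _ _).trans ?_, ?_⟩
  · refine Finset.disjoint_left.2 fun x hx hx' => ?_
    have h1 := hfar _ _ x hx x hx'
    rw [dist_self] at h1
    linarith [dist_pos.2 (hT _ (e i).2)]
  · have hd := dist_pos.2 hxy
    have hεd : ε * dist x y ≤ dist x y := hle x y
    have ht : 0 ≤ ε * dist x y / 8 := by positivity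
    obtain ⟨p, hp, hxp⟩ := hcov x y (ε * dist x y / 8) ht (by linarith) x
    obtain ⟨q, hq, hyq⟩ := hcov x y (ε * dist x y / 8) ht (by linarith) y
    have hlow : 3 / 4 * dist x y ≤ dist p q := by
      linarith [dist_triangle x p y, dist_triangle p q y, dist_comm q y]
    have hupp : dist p q ≤ 5 / 4 * dist x y := by
      linarith [dist_triangle p x q, dist_triangle x y q, dist_comm p x]
    have hpq : p ≠ q := dist_pos.1 (by linarith)
    have hlow' := mul_le_mul_of_nonneg_left hlow hε.le
    have hupp' := mul_le_mul_of_nonneg_left hupp hε.le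
    have hxC : x ∈ C p q := (hmem _ _ _).2 (by linarith)
    have hyC : y ∈ C q p := (hmem _ _ _).2 (by rw [dist_comm q p]; linarith)
    rcases le_total (ρ q) (ρ p) with h | h
    · have hw : (p, q) ∈ T := Finset.mem_filter.2 ⟨Finset.mem_univ _, hpq, h, by
        dsimp only; linarith⟩
      refine ⟨e.symm ⟨(p, q), hw⟩, Or.inl ?_⟩
      simp only [Equiv.apply_symm_apply]
      exact ⟨hxC, hyC⟩
    · have hw : (q, p) ∈ T := Finset.mem_filter.2 ⟨Finset.mem_univ _, hpq.symm, h, by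
        dsimp only; rw [dist_comm q p]; linarith⟩
      refine ⟨e.symm ⟨(q, p), hw⟩, Or.inr ?_⟩
      simp only [Equiv.apply_symm_apply]
      exact ⟨hxC, hyC⟩
  · rw [inv_mul_le_iff₀ hε]
    exact (hmax _ _).trans (mul_le_mul_of_nonneg_left (hfar _ _ p hp q hq) hε.le)
  · exact mul_le_mul_of_nonneg_left (half_le_self dist_nonneg) hε.le
  · have hfib : ∀ q : P, ((T.filter fun w => w.2 = q).card : ℝ) ≤ lam ^ k := by
      intro q
      rcases le_or_gt (ρ q) 0 with hq | hq
      · rw [Finset.card_eq_zero.2, Nat.cast_zero]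
        · positivity
        · refine Finset.filter_eq_empty_iff.2 fun w hw hwq => ?_
          obtain ⟨-, hne, -, h⟩ := Finset.mem_filter.1 hw
          rw [hwq] at h
          have : 0 < ε * dist w.1 q := mul_pos hε (dist_pos.2 (hwq ▸ hne))
          linarith
      · rw [← Finset.card_image_of_injOn (f := Prod.fst)]
        · refine hdoub.card_le_of_separated (x := q) (R := 16 * ρ q / ε) (r := ρ q)
            (by linarith) (by positivity) ?_ ?_ ?_
          · calc 2 * (16 * ρ q / ε) = ρ q * (32 / ε) := by ring
              _ < ρ q * 2 ^ k := mul_lt_mul_of_pos_left hk hq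
          · intro p hp
            obtain ⟨w, hw, rfl⟩ := Finset.mem_image.1 hp
            obtain ⟨hwT, rfl⟩ := Finset.mem_filter.1 hw
            rw [le_div_iff₀ hε, mul_comm, dist_comm]
            exact (Finset.mem_filter.1 hwT).2.2.2
          · have hρ : ∀ p ∈ (T.filter fun w => w.2 = q).image Prod.fst, ρ q ≤ ρ p := by
              intro p hp
              obtain ⟨w, hw, rfl⟩ := Finset.mem_image.1 hp
              obtain ⟨hwT, rfl⟩ := Finset.mem_filter.1 hw
              exact (Finset.mem_filter.1 hwT).2.2.1
            exact fun p hp p' hp' hne => (le_min (hρ p hp) (hρ p' hp')).trans (hsep p p' hne)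
        · intro w hw w' hw' h
          exact Prod.ext h ((Finset.mem_filter.1 hw).2.trans (Finset.mem_filter.1 hw').2.symm)
    calc (T.card : ℝ) = ∑ q : P, ((T.filter fun w => w.2 = q).card : ℝ) := by
          exact_mod_cast Finset.card_eq_sum_card_fiberwise (f := Prod.snd)
            fun w _ => Finset.mem_univ w.2
      _ ≤ ∑ _q : P, lam ^ k := Finset.sum_le_sum fun q _ => hfib q
      _ = Fintype.card P * lam ^ k := by simp
      _ ≤ _ := by gcongr
end

section
/- There is a universal constant c > 0 such that the following holds. Let (P,d) be a finite metric space with doubling constant λ ≥ 2 and |P| = n ≥ 2, and let 0 < ε ≤ 1. Then there exists a set E of unordered pairs of distinct points of P with |E| ≤ n·(2/ε)^{c·log₂ λ}, such that for all x, y ∈ P there is a finite sequence x = x₀, x₁, …, x_k = y with {x_{i−1}, x_i} ∈ E for every 1 ≤ i ≤ k and Σ_{i=1}^{k} d(x_{i−1}, x_i) ≤ (1+ε)·d(x,y). (That is, P admits a (1+ε)-spanner with n·ε^{−O(log λ)} edges.) -/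
open Finset in
/-- In a doubling space, a subset of a ball of radius `r` with pairwise distances greater than
`2 * r / 2 ^ m` has at most `lam ^ m` points. -/
lemma IsDoubling.card_le_pow {P : Type*} [MetricSpace P] {lam : ℝ} (hP : IsDoubling P lam)
    (hlam : 0 ≤ lam) (m : ℕ) (x : P) (r : ℝ) (hr : 0 < r) (T : Finset P)
    (hball : ∀ y ∈ T, dist x y ≤ r)
    (hsep : ∀ y ∈ T, ∀ z ∈ T, y ≠ z → 2 * r / 2 ^ m < dist y z) :
    (#T : ℝ) ≤ lam ^ m := by
  classical
  induction m generalizing x r T with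
  | zero =>
    have h : #T ≤ 1 := by
      refine Finset.card_le_one.2 fun a ha b hb => ?_
      by_contra hab
      have h₁ := hsep a ha b hb hab
      have h₂ := dist_triangle_left a b x
      have h₃ := hball a ha
      have h₄ := hball b hb
      rw [pow_zero, div_one] at h₁
      linarith
    simpa using h
  | succ m ih =>
    obtain ⟨s, hs, hcov⟩ := hP x r hr
    have hsub : T ⊆ s.biUnion fun z => T.filter fun y => dist z y ≤ r / 2 := by
      intro y hy
      obtain ⟨z, hz, hzy⟩ := hcov y (hball y hy)
      exact mem_biUnion.2 ⟨z, hz, mem_filter.2 ⟨hy, hzy⟩⟩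
    have hpart : ∀ z ∈ s, (#(T.filter fun y => dist z y ≤ r / 2) : ℝ) ≤ lam ^ m := by
      intro z _
      refine ih z (r / 2) (by positivity) _ (fun y hy => (mem_filter.1 hy).2) ?_
      intro y hy w hw hyw
      have h := hsep y (mem_filter.1 hy).1 w (mem_filter.1 hw).1 hyw
      calc 2 * (r / 2) / 2 ^ m = 2 * r / 2 ^ (m + 1) := by rw [pow_succ]; field_simp
        _ < dist y w := h
    calc (#T : ℝ) ≤ ∑ z ∈ s, (#(T.filter fun y => dist z y ≤ r / 2) : ℝ) := by
          exact_mod_cast (card_le_card hsub).trans card_biUnion_le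
      _ ≤ #s * lam ^ m := by
          rw [← nsmul_eq_mul]
          exact sum_le_card_nsmul _ _ _ hpart
      _ ≤ lam * lam ^ m := by gcongr
      _ = lam ^ (m + 1) := by ring

/-- Invariant of farthest-first traversal: `S` is the set of points inserted so far, `ρ` records
insertion radii, `h` is the last insertion radius, and `R` is the initial one. -/
structure IsGreedyPrefix {P : Type*} [MetricSpace P] (R : ℝ) (S : Finset P) (ρ : P → ℝ)
    (h : ℝ) : Prop where
  pos : 0 < h
  cover_last : ∀ p, ∃ q ∈ S, dist p q ≤ h
  le_radius : ∀ q ∈ S, h ≤ ρ q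
  sep : ∀ p ∈ S, ∀ q ∈ S, p ≠ q → min (ρ p) (ρ q) ≤ dist p q
  cover : ∀ p r, h < r → r ≤ R → ∃ q ∈ S, r ≤ ρ q ∧ dist p q ≤ r

lemma IsGreedyPrefix.exists_insert {P : Type*} [MetricSpace P] [Fintype P] [DecidableEq P] {R h : ℝ}
    {S : Finset P} {ρ : P → ℝ} (H : IsGreedyPrefix R S ρ h) (hS : S ≠ Finset.univ) :
    ∃ p ∉ S, ∃ ρ' h', IsGreedyPrefix R (insert p S) ρ' h' := by
  obtain ⟨p₀, hp₀⟩ : ∃ p, p ∉ S := by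
    by_contra! hall
    exact hS (Finset.eq_univ_of_forall hall)
  have : Nonempty P := ⟨p₀⟩
  have hSne : S.Nonempty := by
    obtain ⟨q, hq, -⟩ := H.cover_last p₀
    exact ⟨q, hq⟩
  choose near hnear hmin using fun p => S.exists_min_image (dist p) hSne
  obtain ⟨p, hp⟩ := Finite.exists_max fun p => dist p (near p)
  have hpos : 0 < dist p (near p) := by
    refine lt_of_lt_of_le (dist_pos.2 ?_) (hp p₀)
    rintro heq
    exact hp₀ (heq ▸ hnear p₀)
  have hpS : p ∉ S := fun hmem => by
    have := hmin p p hmem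
    rw [dist_self] at this
    linarith
  have hne : ∀ q ∈ S, q ≠ p := fun q hq heq => hpS (heq ▸ hq)
  have hle : dist p (near p) ≤ h := by
    obtain ⟨q, hq, hpq⟩ := H.cover_last p
    exact (hmin p q hq).trans hpq
  refine ⟨p, hpS, Function.update ρ p (dist p (near p)), dist p (near p), hpos, ?_, ?_, ?_, ?_⟩
  · exact fun a => ⟨near a, Finset.mem_insert_of_mem (hnear a), hp a⟩
  · intro q hq
    rcases Finset.mem_insert.1 hq with rfl | hq
    · simp
    · rw [Function.update_of_ne (hne q hq)]
      exact hle.trans (H.le_radius q hq)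
  · intro a ha b hb hab
    rw [Finset.mem_insert] at ha hb
    rcases ha with rfl | ha <;> rcases hb with rfl | hb
    · exact absurd rfl hab
    · exact (min_le_left _ _).trans (by simpa using hmin a b hb)
    · rw [dist_comm a b]
      exact (min_le_right _ _).trans (by simpa using hmin b a ha)
    · rw [Function.update_of_ne (hne a ha), Function.update_of_ne (hne b hb)]
      exact H.sep a ha b hb hab
  · intro a r hr hrR
    rcases lt_or_ge h r with hhr | hrh
    · obtain ⟨q, hq, hrq, haq⟩ := H.cover a r hhr hrR
      exact ⟨q, Finset.mem_insert_of_mem hq, by rwa [Function.update_of_ne (hne q hq)], haq⟩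
    · refine ⟨near a, Finset.mem_insert_of_mem (hnear a), ?_, (hp a).trans hr.le⟩
      rw [Function.update_of_ne (hne _ (hnear a))]
      exact hrh.trans (H.le_radius _ (hnear a))

lemma IsGreedyPrefix.exists_univ {P : Type*} [MetricSpace P] [Fintype P] {R h : ℝ}
    {S : Finset P} {ρ : P → ℝ} (H : IsGreedyPrefix R S ρ h) :
    ∃ ρ' h', IsGreedyPrefix R (Finset.univ : Finset P) ρ' h' := by
  classical
  induction hk : Fintype.card P - S.card generalizing S ρ h with
  | zero =>
    have hS : S = Finset.univ := S.card_eq_iff_eq_univ.1 <| by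
      have := S.card_le_univ
      omega
    exact ⟨ρ, h, hS ▸ H⟩
  | succ k ih =>
    have hS : S ≠ Finset.univ := by
      rintro rfl
      simp at hk
    obtain ⟨p, hpS, ρ', h', H'⟩ := H.exists_insert hS
    refine ih H' ?_
    rw [Finset.card_insert_of_notMem hpS]
    omega

/-- Every nonempty finite metric space has a hierarchy of nets: the points of radius at least `r`
are `r`-separated and `r`-dense, for every positive `r` up to the diameter. -/
lemma exists_net_radii (P : Type*) [MetricSpace P] [Finite P] [Nonempty P] :
    ∃ ρ : P → ℝ, (∀ p, 0 < ρ p) ∧ (∀ p q, p ≠ q → min (ρ p) (ρ q) ≤ dist p q) ∧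
      ∀ (x y p : P) (r : ℝ), 0 < r → r ≤ dist x y → ∃ q, r ≤ ρ q ∧ dist p q ≤ r := by
  have := Fintype.ofFinite P
  obtain ⟨p₀⟩ := ‹Nonempty P›
  set R := Metric.diam (Set.univ : Set P) + 1
  have hR : ∀ x y : P, dist x y ≤ R := fun x y => by
    have := Metric.dist_le_diam_of_mem (Set.finite_univ (α := P)).isBounded
      (Set.mem_univ x) (Set.mem_univ y)
    linarith
  have hR₀ : 0 < R := by
    have := Metric.diam_nonneg (s := (Set.univ : Set P))
    linarith
  have H₀ : IsGreedyPrefix R {p₀} (fun _ => R) R :=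
    { pos := hR₀
      cover_last := fun p => ⟨p₀, Finset.mem_singleton_self _, hR _ _⟩
      le_radius := fun _ _ => le_rfl
      sep := fun p hp q hq hpq =>
        absurd ((Finset.mem_singleton.1 hp).trans (Finset.mem_singleton.1 hq).symm) hpq
      cover := fun _ _ h₁ h₂ => absurd h₂ h₁.not_ge }
  obtain ⟨ρ, h, H⟩ := H₀.exists_univ
  refine ⟨ρ, fun p => H.pos.trans_le (H.le_radius p (Finset.mem_univ p)),
    fun p q => H.sep p (Finset.mem_univ p) q (Finset.mem_univ q), fun x y p r hr hrxy => ?_⟩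
  rcases lt_or_ge h r with hhr | hrh
  · obtain ⟨q, -, hq⟩ := H.cover p r hhr (hrxy.trans (hR x y))
    exact ⟨q, hq⟩
  · exact ⟨p, hrh.trans (H.le_radius p (Finset.mem_univ p)), by simpa using hr.le⟩

/-- `IsPathLength E x y L`: some path from `x` to `y` along edges of `E` has total length `L`. -/
inductive IsPathLength {P : Type*} [MetricSpace P] (E : Finset (Sym2 P)) : P → P → ℝ → Prop
  | nil (x : P) : IsPathLength E x x 0
  | cons {x y z : P} {L : ℝ} (hxy : s(x, y) ∈ E) (h : IsPathLength E y z L) :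
      IsPathLength E x z (dist x y + L)

lemma IsPathLength.trans {P : Type*} [MetricSpace P] {E : Finset (Sym2 P)} {x y z : P} {L M : ℝ}
    (h : IsPathLength E x y L) (h' : IsPathLength E y z M) : IsPathLength E x z (L + M) := by
  induction h with
  | nil x => simpa using h'
  | cons hxy _ ih =>
    rw [add_assoc]
    exact .cons hxy (ih h')

lemma IsPathLength.exists_seq {P : Type*} [MetricSpace P] {E : Finset (Sym2 P)} {x y : P} {L : ℝ}
    (h : IsPathLength E x y L) :
    ∃ (k : ℕ) (f : ℕ → P), f 0 = x ∧ f k = y ∧ (∀ i < k, s(f i, f (i + 1)) ∈ E) ∧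
      ∑ i ∈ Finset.range k, dist (f i) (f (i + 1)) = L := by
  induction h with
  | nil x => exact ⟨0, fun _ => x, rfl, rfl, by simp, by simp⟩
  | @cons x y z L hxy _ ih =>
    obtain ⟨k, f, hf₀, hfk, hE, hsum⟩ := ih
    refine ⟨k + 1, fun i => Nat.casesOn i x f, rfl, hfk, ?_, ?_⟩
    · rintro (_ | i) hi
      · simpa [hf₀] using hxy
      · exact hE i (by omega)
    · rw [Finset.sum_range_succ', ← hsum, add_comm]
      simp [hf₀]

/-- If all pairs of points whose distance is at most `8 / ε` times both net radii are edges, then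
the graph is a `(1 + ε)`-spanner. -/
lemma exists_isPathLength_le {P : Type*} [MetricSpace P] [Finite P] {E : Finset (Sym2 P)} {ε : ℝ}
    (hε : 0 < ε) (hε₁ : ε ≤ 1) {ρ : P → ℝ}
    (hcov : ∀ (x y p : P) (r : ℝ), 0 < r → r ≤ dist x y → ∃ q, r ≤ ρ q ∧ dist p q ≤ r)
    (hE : ∀ p q : P, p ≠ q → dist p q ≤ 8 / ε * ρ p → dist p q ≤ 8 / ε * ρ q → s(p, q) ∈ E)
    (x y : P) : ∃ L ≤ (1 + ε) * dist x y, IsPathLength E x y L := by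
  let lt : P × P → P × P → Prop := fun a b => dist a.1 a.2 < dist b.1 b.2
  have : IsTrans (P × P) lt := ⟨fun _ _ _ h h' => lt_trans h h'⟩
  have : Std.Irrefl lt := ⟨fun _ h => lt_irrefl _ h⟩
  have hwf : WellFounded lt := Finite.wellFounded_of_trans_of_irrefl lt
  suffices h : ∀ a : P × P, ∃ L ≤ (1 + ε) * dist a.1 a.2, IsPathLength E a.1 a.2 L from h (x, y)
  intro a
  induction a using hwf.induction with
  | _ a ih =>
  obtain ⟨x, y⟩ := a
  dsimp only at ih ⊢
  rcases eq_or_ne x y with rfl | hxy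
  · exact ⟨0, by simp, .nil x⟩
  have hD : 0 < dist x y := dist_pos.2 hxy
  set D := dist x y
  set r := ε * D / 6 with hr
  have hr₀ : 0 < r := by positivity
  have hrD : 6 * r ≤ D := by
    rw [hr]
    nlinarith
  obtain ⟨p, hpr, hxp⟩ := hcov x y x r hr₀ (by linarith)
  obtain ⟨q, hqr, hyq⟩ := hcov x y y r hr₀ (by linarith)
  have hqy : dist q y ≤ r := by rwa [dist_comm]
  obtain ⟨L, hL, hLp⟩ := ih (x, p) (show dist x p < dist x y by linarith)
  obtain ⟨M, hM, hMp⟩ := ih (q, y) (show dist q y < dist x y by linarith)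
  dsimp only at hL hLp hM hMp
  have hpq_le : dist p q ≤ D + 2 * r := by
    have h₁ := dist_triangle4 p x y q
    rw [dist_comm p x] at h₁
    linarith
  have hpq : p ≠ q := by
    rintro rfl
    have := dist_triangle x p y
    linarith
  have hbound : D + 2 * r ≤ 8 / ε * r := by
    have : 8 / ε * r = 8 * D / 6 := by
      rw [hr]
      field_simp
    linarith
  have hedge : s(p, q) ∈ E := by
    have h₈ : 0 ≤ 8 / ε := by positivity
    exact hE p q hpq (hpq_le.trans (hbound.trans (by gcongr)))
      (hpq_le.trans (hbound.trans (by gcongr)))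
  refine ⟨L + (dist p q + M), ?_, hLp.trans (.cons hedge hMp)⟩
  have h₁ : (1 + ε) * dist x p ≤ 2 * r := by nlinarith [dist_nonneg (x := x) (y := p)]
  have h₂ : (1 + ε) * dist q y ≤ 2 * r := by nlinarith [dist_nonneg (x := q) (y := y)]
  have h₃ : (1 + ε) * D = D + 6 * r := by
    rw [hr]
    ring
  linarith

lemma exists_pow_two_gt_and_pow_le {lam ε : ℝ} (hlam : 2 ≤ lam) (hε : 0 < ε) (hε₁ : ε ≤ 1) :
    ∃ m : ℕ, 16 / ε < 2 ^ m ∧ lam ^ m ≤ (2 / ε) ^ (5 * Real.logb 2 lam) := by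
  have hone : (1 : ℝ) ≤ 16 / ε := by
    rw [le_div_iff₀ hε]
    linarith
  obtain ⟨k, hk, hk'⟩ := exists_nat_pow_near hone (one_lt_two : (1 : ℝ) < 2)
  refine ⟨k + 1, hk', ?_⟩
  have htwo : 2 ≤ 2 / ε := by
    rw [le_div_iff₀ hε]
    linarith
  have hlog : 0 ≤ Real.logb 2 lam := Real.logb_nonneg one_lt_two (by linarith)
  have hpow : (2 : ℝ) ^ (k + 1) ≤ (2 / ε) ^ 5 := by
    calc (2 : ℝ) ^ (k + 1) = 2 ^ k * 2 := pow_succ _ _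
      _ ≤ 16 / ε * 2 := by gcongr
      _ = 2 ^ 4 * (2 / ε) := by ring
      _ ≤ (2 / ε) ^ 4 * (2 / ε) := by gcongr
      _ = (2 / ε) ^ 5 := by ring
  calc lam ^ (k + 1) = ((2 : ℝ) ^ Real.logb 2 lam) ^ (k + 1) := by
        rw [Real.rpow_logb two_pos (by norm_num) (by linarith)]
    _ = ((2 : ℝ) ^ (k + 1)) ^ Real.logb 2 lam := by
        rw [Real.rpow_pow_comm zero_le_two]
    _ ≤ ((2 / ε) ^ 5) ^ Real.logb 2 lam := by gcongr
    _ = (2 / ε) ^ (5 * Real.logb 2 lam) := by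
        rw [Real.rpow_mul (by positivity)]
        norm_cast

theorem stmt8 :
    ∃ c : ℝ, 0 < c ∧
      ∀ (P : Type) [MetricSpace P] [Fintype P] (lam : ℝ),
        IsDoubling P lam → 2 ≤ lam → 2 ≤ Fintype.card P →
        ∀ ε : ℝ, 0 < ε → ε ≤ 1 →
        ∃ E : Finset (Sym2 P),
          (∀ e ∈ E, ¬ e.IsDiag) ∧
          (E.card : ℝ) ≤ (Fintype.card P : ℝ) * (2 / ε) ^ (c * Real.logb 2 lam) ∧
          ∀ x y : P, ∃ (k : ℕ) (f : ℕ → P), f 0 = x ∧ f k = y ∧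
            (∀ i < k, s(f i, f (i + 1)) ∈ E) ∧
            (∑ i ∈ Finset.range k, dist (f i) (f (i + 1))) ≤ (1 + ε) * dist x y := by
  classical
  refine ⟨5, by norm_num, fun P _ _ lam hP hlam hcard ε hε hε₁ => ?_⟩
  have : Nonempty P := Fintype.card_pos_iff.1 (by omega)
  obtain ⟨ρ, hρ, hsep, hcov⟩ := exists_net_radii P
  obtain ⟨m, hm, hlm⟩ := exists_pow_two_gt_and_pow_le hlam hε hε₁
  let T : P → Finset P := fun u =>
    Finset.univ.filter fun v => u ≠ v ∧ ρ u ≤ ρ v ∧ dist u v ≤ 8 / ε * ρ u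
  have hT : ∀ u v, v ∈ T u ↔ u ≠ v ∧ ρ u ≤ ρ v ∧ dist u v ≤ 8 / ε * ρ u := by simp [T]
  have hTcard : ∀ u, ((T u).card : ℝ) ≤ lam ^ m := fun u => by
    have hu := hρ u
    refine hP.card_le_pow (by linarith) m u (8 / ε * ρ u) (by positivity) (T u)
      (fun v hv => ((hT u v).1 hv).2.2) fun v hv w hw hvw => ?_
    calc 2 * (8 / ε * ρ u) / 2 ^ m = 16 / ε * ρ u / 2 ^ m := by ring
      _ < ρ u := by
        rw [div_lt_iff₀ (by positivity), mul_comm]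
        gcongr
      _ ≤ min (ρ v) (ρ w) := le_min ((hT u v).1 hv).2.1 ((hT u w).1 hw).2.1
      _ ≤ dist v w := hsep v w hvw
  let E : Finset (Sym2 P) := Finset.univ.biUnion fun u => (T u).image fun v => s(u, v)
  have hE : ∀ u v, v ∈ T u → s(u, v) ∈ E := fun u v hv =>
    Finset.mem_biUnion.2 ⟨u, Finset.mem_univ u, Finset.mem_image_of_mem _ hv⟩
  refine ⟨E, ?_, ?_, fun x y => ?_⟩
  · intro e he
    obtain ⟨u, -, hu⟩ := Finset.mem_biUnion.1 he
    obtain ⟨v, hv, rfl⟩ := Finset.mem_image.1 hu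
    simpa using ((hT u v).1 hv).1
  · calc (E.card : ℝ) ≤ ∑ u, ((T u).card : ℝ) := by
          exact_mod_cast Finset.card_biUnion_le.trans
            (Finset.sum_le_sum fun u _ => Finset.card_image_le)
      _ ≤ Fintype.card P * lam ^ m := by
          rw [← nsmul_eq_mul]
          exact Finset.sum_le_card_nsmul _ _ _ fun u _ => hTcard u
      _ ≤ _ := by gcongr
  · have hadj : ∀ p q, p ≠ q → dist p q ≤ 8 / ε * ρ p → dist p q ≤ 8 / ε * ρ q →
        s(p, q) ∈ E := by
      intro p q hpq hp hq
      rcases le_total (ρ p) (ρ q) with h | h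
      · exact hE p q ((hT p q).2 ⟨hpq, h, hp⟩)
      · rw [Sym2.eq_swap]
        exact hE q p ((hT q p).2 ⟨hpq.symm, h, by rwa [dist_comm]⟩)
    obtain ⟨L, hL, hpath⟩ := exists_isPathLength_le hε hε₁ hcov hadj x y
    obtain ⟨k, f, hf₀, hfk, hfE, hsum⟩ := hpath.exists_seq
    exact ⟨k, f, hf₀, hfk, hfE, hsum.trans_le hL⟩
end

section
/- Let (P,d) be a finite metric space and 0 < δ ≤ 1/16. Let (A_i, B_i), 1 ≤ i ≤ s, be pairs of nonempty subsets of P such that: A_i ∩ B_i = ∅ for every i; for every pair of distinct x, y ∈ P there is i with (x ∈ A_i and y ∈ B_i) or (x ∈ B_i and y ∈ A_i); and d(A_i,B_i) ≥ δ^{−1}·max(diam A_i, diam B_i) for every i. Suppose further that for each i there are chosen points a_i ∈ A_i and b_i ∈ B_i with max(diam A_i, diam B_i) ≤ δ·d(a_i, b_i). Let E = { {a_i, b_i} : 1 ≤ i ≤ s }. Then for all x, y ∈ P there is a finite sequence x = x₀, x₁, …, x_k = y with {x_{j−1}, x_j} ∈ E for every 1 ≤ j ≤ k and Σ_{j=1}^{k}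 d(x_{j−1}, x_j) ≤ (1+16δ)·d(x,y). -/
/-- `x` and `y` are joined by a walk along `R` of total length at most `c`. -/
def HasWalkOfLengthLE {P : Type*} [MetricSpace P] (R : P → P → Prop) (x y : P) (c : ℝ) : Prop :=
  ∃ (k : ℕ) (f : ℕ → P), f 0 = x ∧ f k = y ∧ (∀ j < k, R (f j) (f (j + 1))) ∧
    (∑ j ∈ Finset.range k, dist (f j) (f (j + 1))) ≤ c

namespace HasWalkOfLengthLE

variable {P : Type*} [MetricSpace P] {R : P → P → Prop} {x y z : P} {c c' : ℝ}

theorem mono (h : HasWalkOfLengthLE R x y c) (hc : c ≤ c') : HasWalkOfLengthLE R x y c' := by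
  obtain ⟨k, f, h0, hk, hR, hs⟩ := h
  exact ⟨k, f, h0, hk, hR, hs.trans hc⟩

theorem refl (x : P) : HasWalkOfLengthLE R x x 0 :=
  ⟨0, fun _ => x, rfl, rfl, by simp, by simp⟩

theorem of_rel (h : R x y) : HasWalkOfLengthLE R x y (dist x y) := by
  refine ⟨1, fun j => if j = 0 then x else y, by simp, by simp, ?_, by simp⟩
  intro j hj
  obtain rfl : j = 0 := by omega
  simpa using h

theorem trans (h : HasWalkOfLengthLE R x y c) (h' : HasWalkOfLengthLE R y z c') :
    HasWalkOfLengthLE R x z (c + c') := by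
  obtain ⟨k, f, h0, hk, hR, hs⟩ := h
  obtain ⟨l, g, g0, gl, gR, gs⟩ := h'
  set w : ℕ → P := fun j => if j < k then f j else g (j - k) with hw
  have hleft : ∀ j ≤ k, w j = f j := by
    intro j hj
    rcases hj.lt_or_eq with hj | rfl
    · simp [hw, hj]
    · simp [hw, g0, hk]
  have hright : ∀ j, w (k + j) = g j := fun j => by simp [hw]
  refine ⟨k + l, w, by rw [hleft 0 k.zero_le, h0], by rw [hright, gl], ?_, ?_⟩
  · intro j hj
    rcases lt_or_ge j k with hjk | hjk
    · rw [hleft j hjk.le, hleft (j + 1) hjk]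
      exact hR j hjk
    · obtain ⟨m, rfl⟩ := Nat.exists_eq_add_of_le hjk
      rw [add_assoc, hright, hright]
      exact gR m (by omega)
  · rw [Finset.sum_range_add]
    refine add_le_add (le_of_eq_of_le (Finset.sum_congr rfl fun j hj => ?_) hs)
      (le_of_eq_of_le (Finset.sum_congr rfl fun j _ => ?_) gs)
    · have := Finset.mem_range.mp hj
      rw [hleft j this.le, hleft (j + 1) this]
    · rw [add_assoc, hright, hright]

end HasWalkOfLengthLE

/-- If any two distinct points have `R`-related representatives at distance at most `δ` times their
own distance, then `R` is a `(1 + 16 * δ)`-spanner. -/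
theorem hasWalkOfLengthLE_of_representatives {P : Type*} [MetricSpace P] [Finite P]
    {R : P → P → Prop} {δ : ℝ} (hδ0 : 0 < δ) (hδ : δ ≤ 1 / 16)
    (hR : ∀ x y : P, x ≠ y →
      ∃ p q, R p q ∧ dist x p ≤ δ * dist x y ∧ dist q y ≤ δ * dist x y)
    (x y : P) : HasWalkOfLengthLE R x y ((1 + 16 * δ) * dist x y) := by
  let r : P × P → P × P → Prop := fun u v => dist u.1 u.2 < dist v.1 v.2
  have : IsTrans (P × P) r := ⟨fun _ _ _ => lt_trans⟩
  have : Std.Irrefl r := ⟨fun _ => lt_irrefl _⟩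
  suffices ∀ u : P × P, HasWalkOfLengthLE R u.1 u.2 ((1 + 16 * δ) * dist u.1 u.2) from this (x, y)
  intro u
  induction u using (Finite.wellFounded_of_trans_of_irrefl r).induction with
  | _ u ih =>
  obtain ⟨x, y⟩ := u
  rcases eq_or_ne x y with rfl | hxy
  · simpa using HasWalkOfLengthLE.refl (R := R) x
  obtain ⟨p, q, hpq, hxp, hqy⟩ := hR x y hxy
  have hD : 0 < dist x y := dist_pos.mpr hxy
  have hlt : δ * dist x y < dist x y := by nlinarith
  refine (((ih (x, p) (hxp.trans_lt hlt)).trans (.of_rel hpq)).trans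
    (ih (q, y) (hqy.trans_lt hlt))).mono ?_
  have htri : dist p q ≤ dist x p + dist x y + dist q y := by
    have := dist_triangle4 p x y q
    rwa [dist_comm p x, dist_comm y q] at this
  have hsq : δ * (δ * dist x y) ≤ 1 / 16 * (δ * dist x y) :=
    mul_le_mul_of_nonneg_right hδ (by positivity)
  have h₁ := mul_le_mul_of_nonneg_left hxp hδ0.le
  have h₂ := mul_le_mul_of_nonneg_left hqy hδ0.le
  have := mul_pos hδ0 hD
  dsimp only
  linarith

theorem stmt9 {P : Type*} [MetricSpace P] [Fintype P]
    (δ : ℝ) (hδ0 : 0 < δ) (hδ : δ ≤ 1 / 16)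
    (s : ℕ) (A B : Fin s → Finset P) (a b : Fin s → P)
    (hA : ∀ i, (A i).Nonempty) (hB : ∀ i, (B i).Nonempty)
    (hdisj : ∀ i, Disjoint (A i) (B i))
    (hcover : ∀ x y : P, x ≠ y → ∃ i, (x ∈ A i ∧ y ∈ B i) ∨ (x ∈ B i ∧ y ∈ A i))
    (hsep : ∀ i, ∀ p ∈ A i, ∀ q ∈ B i,
      δ⁻¹ * max (Metric.diam ((A i : Finset P) : Set P))
          (Metric.diam ((B i : Finset P) : Set P)) ≤ dist p q)
    (ha : ∀ i, a i ∈ A i) (hb : ∀ i, b i ∈ B i)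
    (hrep : ∀ i, max (Metric.diam ((A i : Finset P) : Set P))
        (Metric.diam ((B i : Finset P) : Set P)) ≤ δ * dist (a i) (b i)) :
    ∀ x y : P, ∃ (k : ℕ) (f : ℕ → P), f 0 = x ∧ f k = y ∧
      (∀ j < k, ∃ i, (f j = a i ∧ f (j + 1) = b i) ∨ (f j = b i ∧ f (j + 1) = a i)) ∧
      (∑ j ∈ Finset.range k, dist (f j) (f (j + 1))) ≤ (1 + 16 * δ) * dist x y := by
  refine hasWalkOfLengthLE_of_representatives
    (R := fun u v => ∃ i, (u = a i ∧ v = b i) ∨ (u = b i ∧ v = a i)) hδ0 hδ fun x y hxy => ?_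
  have hdiam : ∀ i, ∀ p ∈ A i, ∀ q ∈ B i,
      dist p (a i) ≤ δ * dist p q ∧ dist q (b i) ≤ δ * dist p q := by
    intro i p hp q hq
    have h := (inv_mul_le_iff₀ hδ0).mp (hsep i p hp q hq)
    exact ⟨(Metric.dist_le_diam_of_mem (A i).finite_toSet.isBounded hp (ha i)).trans
        ((le_max_left _ _).trans h),
      (Metric.dist_le_diam_of_mem (B i).finite_toSet.isBounded hq (hb i)).trans
        ((le_max_right _ _).trans h)⟩
  obtain ⟨i, ⟨hx, hy⟩ | ⟨hx, hy⟩⟩ := hcover x y hxy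
  · obtain ⟨h₁, h₂⟩ := hdiam i x hx y hy
    exact ⟨a i, b i, ⟨i, .inl ⟨rfl, rfl⟩⟩, h₁, by rwa [dist_comm (b i)]⟩
  · obtain ⟨h₁, h₂⟩ := hdiam i y hy x hx
    rw [dist_comm y x] at h₁ h₂
    exact ⟨b i, a i, ⟨i, .inr ⟨rfl, rfl⟩⟩, h₂, by rwa [dist_comm (a i)]⟩
end

section
/- There is a universal constant c > 0 such that the following holds. Let (P,d) be a finite nonempty metric space with doubling constant λ ≥ 2. Then there exists a function μ : P → ℝ with μ(x) > 0 for every x ∈ P, Σ_{x∈P} μ(x) = 1, and μ(B(x,2r)) ≤ λ^{c}·μ(B(x,r)) for every x ∈ P and every r > 0, where μ(S) := Σ_{y∈S} μ(y) for S ⊆ P. (That is, every finite doubling metric space carries a λ^{O(1)}-doubling measure.) -/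
theorem IsDoubling.exists_cover {P : Type*} [MetricSpace P] {lam : ℝ} (h : IsDoubling P lam)
    (hlam : 0 ≤ lam) (j : ℕ) (x : P) {t : ℝ} (ht : 0 < t) :
    ∃ s : Finset P, (s.card : ℝ) ≤ lam ^ j ∧
      ∀ y, dist x y ≤ t → ∃ z ∈ s, dist z y ≤ t / 2 ^ j := by
  classical
  induction j with
  | zero => exact ⟨{x}, by simp, fun y hy => ⟨x, by simp, by simpa using hy⟩⟩
  | succ j ih =>
    obtain ⟨s, hs, hcov⟩ := ih
    choose f hf hfcov using fun z => h z (t / 2 ^ j) (by positivity)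
    refine ⟨s.biUnion f, ?_, fun y hy => ?_⟩
    · calc ((s.biUnion f).card : ℝ) ≤ ∑ z ∈ s, ((f z).card : ℝ) := by
            exact_mod_cast Finset.card_biUnion_le
        _ ≤ ∑ _z ∈ s, lam := Finset.sum_le_sum fun z _ => hf z
        _ = s.card * lam := by simp
        _ ≤ lam ^ j * lam := by gcongr
        _ = lam ^ (j + 1) := (pow_succ _ _).symm
    · obtain ⟨z, hz, hzy⟩ := hcov y hy
      obtain ⟨w, hw, hwy⟩ := hfcov z y hzy
      refine ⟨w, Finset.mem_biUnion.2 ⟨z, hz, hw⟩, hwy.trans_eq ?_⟩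
      rw [pow_succ, div_div]

theorem IsDoubling.card_le_of_separated_s13 {P : Type*} [MetricSpace P] {lam : ℝ}
    (h : IsDoubling P lam) (hlam : 0 ≤ lam) (j : ℕ) (x : P) {t ρ : ℝ} (ht : 0 < t)
    (hρ : 2 * (t / 2 ^ j) < ρ) (S : Finset P) (hS : ∀ y ∈ S, dist x y ≤ t)
    (hsep : ∀ y ∈ S, ∀ z ∈ S, y ≠ z → ρ ≤ dist y z) : (S.card : ℝ) ≤ lam ^ j := by
  obtain ⟨s, hs, hcov⟩ := h.exists_cover hlam j x ht
  choose! f hf hfd using fun y (hy : y ∈ S) => hcov y (hS y hy)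
  refine le_trans ?_ hs
  exact_mod_cast Finset.card_le_card_of_injOn f hf fun y hy z hz hyz => by
    by_contra hne
    have h1 := hfd y hy
    have h2 := hfd z hz
    rw [← hyz] at h2
    linarith [hsep y hy z hz hne, dist_triangle_left y z (f y)]

/-- `N` is a `ρ`-net: its points are at mutual distance at least `ρ`, and every point of the
space is within `ρ` of it. -/
structure IsNet {P : Type*} [MetricSpace P] (ρ : ℝ) (N : Finset P) : Prop where
  separated : ∀ x ∈ N, ∀ y ∈ N, x ≠ y → ρ ≤ dist x y
  cover : ∀ x, ∃ y ∈ N, dist x y ≤ ρ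

theorem IsNet.exists_superset {P : Type*} [MetricSpace P] [Fintype P] {ρ ρ' : ℝ} {N : Finset P}
    (h : IsNet ρ N) (h0 : 0 ≤ ρ') (hρ : ρ' ≤ ρ) : ∃ N', N ⊆ N' ∧ IsNet ρ' N' := by
  classical
  obtain ⟨N', hN', hmax⟩ := Finset.exists_max_image
    (Finset.univ.filter fun S : Finset P =>
      N ⊆ S ∧ ∀ x ∈ S, ∀ y ∈ S, x ≠ y → ρ' ≤ dist x y) Finset.card
    ⟨N, by simpa using fun x hx y hy hne => hρ.trans (h.separated x hx y hy hne)⟩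
  simp only [Finset.mem_filter, Finset.mem_univ, true_and] at hN' hmax
  refine ⟨N', hN'.1, hN'.2, fun x => ?_⟩
  by_contra! hx
  have hxN : x ∉ N' := fun hxN => absurd (hx x hxN) (by simpa using h0)
  have := hmax (insert x N') ⟨hN'.1.trans (Finset.subset_insert _ _), fun a ha b hb hab => ?_⟩
  · rw [Finset.card_insert_of_notMem hxN] at this
    omega
  · rcases Finset.mem_insert.1 ha with rfl | ha' <;>
      rcases Finset.mem_insert.1 hb with rfl | hb'
    · exact absurd rfl hab
    · exact (hx b hb').le
    · rw [dist_comm]; exact (hx a ha').le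
    · exact hN'.2 a ha' b hb' hab

/-- A weight on a `ρ`-net which is balanced at scale `12ρ` can be redistributed to a finer net,
staying balanced with the same constant. -/
theorem IsNet.exists_refinement {P : Type*} [MetricSpace P] [Fintype P] [DecidableEq P]
    {ρ M : ℝ} {N : Finset P} (hN : IsNet ρ N) (hρ : 0 < ρ) (hM : 1 ≤ M)
    (hcard : ∀ (x : P) (S : Finset P), (∀ y ∈ S, dist x y ≤ ρ) →
      (∀ y ∈ S, ∀ z ∈ S, y ≠ z → ρ / 32 ≤ dist y z) → (S.card : ℝ) ≤ M)
    {μ : P → ℝ} (hpos : ∀ x ∈ N, 0 < μ x)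
    (hbal : ∀ x ∈ N, ∀ y ∈ N, dist x y ≤ 12 * ρ → μ x ≤ M * μ y) :
    ∃ (N' : Finset P) (μ' : P → ℝ) (p : P → P), IsNet (ρ / 32) N' ∧ (∀ x ∈ N', 0 < μ' x) ∧
      (∀ x ∈ N', ∀ y ∈ N', dist x y ≤ 12 * (ρ / 32) → μ' x ≤ M * μ' y) ∧
      (∀ x, p x ∈ N ∧ dist x (p x) ≤ ρ) ∧
      (∀ x ∈ N, ∑ z ∈ N'.filter (fun z => p z = x), μ' z = μ x) ∧
      ∀ z ∈ N', μ (p z) ≤ M * μ' z := by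
  obtain ⟨N', hsub, hN'⟩ := hN.exists_superset (ρ' := ρ / 32) (by positivity) (by linarith)
  have hmin : ∀ x, ∃ y ∈ N, ∀ z ∈ N, dist x y ≤ dist x z := fun x =>
    Finset.exists_min_image N _ ((hN.cover x).imp fun _ h => h.1)
  choose p hpN hpmin using hmin
  have hpd : ∀ x, dist x (p x) ≤ ρ := fun x => by
    obtain ⟨y, hy, hxy⟩ := hN.cover x
    exact (hpmin x y hy).trans hxy
  have hpnear : ∀ x ∈ N, ∀ y, dist y x < ρ / 2 → p y = x := fun x hx y hxy => by
    by_contra hne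
    linarith [hN.separated _ (hpN y) x hx hne, hpmin y x hx, dist_triangle_left (p y) x y]
  have hpself : ∀ x ∈ N, p x = x := fun x hx => hpnear x hx x (by simpa using by positivity)
  have hM0 : 0 < M := by linarith
  let C : P → Finset P := fun x => N'.filter fun z => p z = x
  have hCM : ∀ x, ((C x).card : ℝ) ≤ M := fun x => by
    refine hcard x _ (fun y hy => ?_) fun y hy z hz => ?_
    · have hy := (Finset.mem_filter.1 hy).2
      rw [← hy, dist_comm]; exact hpd y
    · exact hN'.separated y (Finset.mem_filter.1 hy).1 z (Finset.mem_filter.1 hz).1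
  have hmemC : ∀ x ∈ N, x ∈ C x := fun x hx => Finset.mem_filter.2 ⟨hsub hx, hpself x hx⟩
  have hC1 : ∀ x ∈ N, (1 : ℝ) ≤ (C x).card := fun x hx => by
    exact_mod_cast Finset.card_pos.2 ⟨x, hmemC x hx⟩
  let μ' : P → ℝ := fun x =>
    if x ∈ N then μ x * (1 - ((C x).card - 1) / M) else μ (p x) / M
  have hself : ∀ x ∈ N, μ' x = μ x * (1 - ((C x).card - 1) / M) := fun x hx => if_pos hx
  have hother : ∀ x, x ∉ N → μ' x = μ (p x) / M := fun x hx => if_neg hx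
  have hlow : ∀ z, μ (p z) ≤ M * μ' z := fun z => by
    by_cases hz : z ∈ N
    · rw [hself z hz, hpself z hz]
      have : M * (μ z * (1 - ((C z).card - 1) / M)) = μ z * (M - (C z).card + 1) := by
        field_simp; ring
      rw [this]
      nlinarith [hpos z hz, hCM z]
    · rw [hother z hz]
      field_simp; rfl
  have hup : ∀ x ∈ N, μ' x ≤ μ x := fun x hx => by
    rw [hself x hx]
    have : 0 ≤ ((C x).card - 1 : ℝ) / M := div_nonneg (by linarith [hC1 x hx]) hM0.le
    nlinarith [hpos x hx]
  refine ⟨N', μ', p, hN', fun x _ => ?_, fun x hx y hy hxy => ?_, fun x => ⟨hpN x, hpd x⟩,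
    fun x hx => ?_, fun z _ => hlow z⟩
  · exact pos_of_mul_pos_right ((hpos _ (hpN x)).trans_le (hlow x)) hM0.le
  · by_cases hxN : x ∈ N
    · have : p y = x := hpnear x hxN y (by rw [dist_comm]; linarith)
      exact (hup x hxN).trans (this ▸ hlow y)
    · rw [hother x hxN, div_le_iff₀ hM0]
      have h1 : dist (p x) (p y) ≤ 12 * ρ := by
        linarith [dist_triangle4 (p x) x y (p y), hpd x, hpd y, dist_comm x (p x)]
      have h2 := hbal _ (hpN x) _ (hpN y) h1
      have h3 := mul_le_mul_of_nonneg_left (hlow y) hM0.le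
      linarith
  · change ∑ z ∈ C x, μ' z = μ x
    rw [← Finset.add_sum_erase _ _ (hmemC x hx), hself x hx,
      Finset.sum_congr rfl (g := fun _ => μ x / M) fun z hz => ?_]
    · rw [Finset.sum_const, Finset.card_erase_of_mem (hmemC x hx), nsmul_eq_mul,
        Nat.cast_sub (by exact_mod_cast hC1 x hx)]
      push_cast
      field_simp; ring
    · obtain ⟨hzx, hz⟩ := Finset.mem_erase.1 hz
      have hz := (Finset.mem_filter.1 hz).2
      rw [hother z fun hzN => hzx ((hpself z hzN).symm.trans hz), hz]

/-- A balanced weight on a `ρ`-net extends to a measure which is doubling at radii below `4ρ`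
and gives each point of the net's Voronoi-like cell the prescribed mass. -/
theorem IsNet.exists_doubling_extension {P : Type*} [MetricSpace P] [Fintype P] [DecidableEq P]
    {lam : ℝ} (h : IsDoubling P lam) (hlam : 1 ≤ lam) {δ : ℝ}
    (hδ : ∀ x y : P, x ≠ y → δ ≤ dist x y) (n : ℕ) :
    ∀ {ρ : ℝ} {N : Finset P} {μ : P → ℝ}, IsNet ρ N → 0 < ρ → 8 * ρ < δ * 32 ^ n →
      (∀ x ∈ N, 0 < μ x) →
      (∀ x ∈ N, ∀ y ∈ N, dist x y ≤ 12 * ρ → μ x ≤ lam ^ 7 * μ y) →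
      ∃ (ν : P → ℝ) (π : P → P), (∀ x, 0 < ν x) ∧ (∀ x, π x ∈ N ∧ dist x (π x) ≤ 2 * ρ) ∧
        (∀ z ∈ N, ∑ x with π x = z, ν x = μ z) ∧
        ∀ x r, 0 < r → r < 4 * ρ →
          (∑ y ∈ Finset.univ.filter (fun y => dist x y ≤ 2 * r), ν y) ≤
            lam ^ 19 * ∑ y ∈ Finset.univ.filter (fun y => dist x y ≤ r), ν y := by
  have hlam0 : 0 ≤ lam := by linarith
  induction n with
  | zero =>
    intro ρ N μ hN hρ hρδ hpos _
    have hmem : ∀ x, x ∈ N := fun x => by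
      obtain ⟨y, hy, hxy⟩ := hN.cover x
      by_cases hne : x = y
      · rwa [hne]
      · linarith [hδ x y hne]
    refine ⟨μ, id, fun x => hpos x (hmem x), fun x => ⟨hmem x, by simpa using hρ.le⟩,
      fun z _ => by simp [Finset.filter_eq'], fun x r hr hrρ => ?_⟩
    have hsub : Finset.univ.filter (fun y => dist x y ≤ 2 * r) ⊆
        Finset.univ.filter (fun y => dist x y ≤ r) := fun y hy => by
      simp only [Finset.mem_filter, Finset.mem_univ, true_and] at hy ⊢
      by_cases hne : x = y
      · simpa [hne] using hr.le
      · linarith [hδ x y hne]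
    have hnn : ∀ y, 0 ≤ μ y := fun y => (hpos y (hmem y)).le
    exact (Finset.sum_le_sum_of_subset_of_nonneg hsub fun y _ _ => hnn y).trans
      (le_mul_of_one_le_left (Finset.sum_nonneg fun y _ => hnn y) (one_le_pow₀ hlam))
  | succ n ih =>
    intro ρ N μ hN hρ hρδ hpos hbal
    obtain ⟨N', μ', p, hN', hpos', hbal', hp, hsum, hlow⟩ :=
      hN.exists_refinement hρ (one_le_pow₀ hlam) (fun x S hS hsep =>
        h.card_le_of_separated_s13 hlam0 7 x hρ (by norm_num; linarith) S hS hsep) hpos hbal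
    obtain ⟨ν, π, hν, hπ, hcell, hdoub⟩ := ih hN' (by positivity)
      (by rw [pow_succ] at hρδ; linarith) hpos' hbal'
    have hcell2 : ∀ z ∈ N, ∑ x with p (π x) = z, ν x = μ z := fun z hz => by
      rw [← hsum z hz, ← Finset.sum_fiberwise_of_maps_to (g := π)
        (t := N'.filter fun w => p w = z) (fun x hx => by
          simpa using ⟨(hπ x).1, (Finset.mem_filter.1 hx).2⟩)]
      refine Finset.sum_congr rfl fun w hw => ?_
      obtain ⟨hw, hpw⟩ := Finset.mem_filter.1 hw
      rw [← hcell w hw, Finset.filter_filter]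
      refine Finset.sum_congr (Finset.filter_congr fun x _ => ?_) fun _ _ => rfl
      exact ⟨fun hx => hx.2, fun hx => ⟨by rw [hx, hpw], hx⟩⟩
    have hπ2 : ∀ x, dist x (p (π x)) ≤ 2 * ρ := fun x => by
      linarith [dist_triangle x (π x) (p (π x)), (hπ x).2, (hp (π x)).2]
    refine ⟨ν, p ∘ π, hν, fun x => ⟨(hp _).1, hπ2 x⟩, hcell2, fun x r hr hrρ => ?_⟩
    by_cases hr' : r < 4 * (ρ / 32)
    · exact hdoub x r hr hr'
    · let K : Finset P := N.filter fun z => dist (p (π x)) z ≤ 12 * ρ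
      have hK : (K.card : ℝ) ≤ lam ^ 5 :=
        h.card_le_of_separated_s13 hlam0 5 (p (π x)) (t := 12 * ρ) (by positivity)
          (by norm_num; linarith) K (fun y hy => (Finset.mem_filter.1 hy).2)
          fun y hy z hz => hN.separated y (Finset.mem_filter.1 hy).1 z (Finset.mem_filter.1 hz).1
      have hxN := (hp (π x)).1
      have hinner : μ' (π x) ≤ ∑ y ∈ Finset.univ.filter (fun y => dist x y ≤ r), ν y := by
        rw [← hcell _ (hπ x).1]
        refine Finset.sum_le_sum_of_subset_of_nonneg (fun y hy => ?_) fun y _ _ => (hν y).le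
        simp only [Finset.mem_filter, Finset.mem_univ, true_and] at hy ⊢
        have h1 := (hπ y).2
        rw [hy] at h1
        linarith [dist_triangle_right x y (π x), (hπ x).2]
      calc ∑ y ∈ Finset.univ.filter (fun y => dist x y ≤ 2 * r), ν y
          ≤ ∑ y ∈ Finset.univ.filter (fun y => p (π y) ∈ K), ν y := by
            refine Finset.sum_le_sum_of_subset_of_nonneg (fun y hy => ?_) fun y _ _ => (hν y).le
            simp only [Finset.mem_filter, Finset.mem_univ, true_and, K] at hy ⊢
            refine ⟨(hp _).1, ?_⟩
            linarith [dist_triangle4 (p (π x)) x y (p (π y)), hπ2 x, hπ2 y,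
              dist_comm x (p (π x))]
        _ = ∑ z ∈ K, μ z := by
            rw [← Finset.sum_fiberwise_of_maps_to (g := fun y => p (π y)) (t := K)
              (fun y hy => (Finset.mem_filter.1 hy).2)]
            refine Finset.sum_congr rfl fun z hz => ?_
            rw [← hcell2 z (Finset.mem_filter.1 hz).1, Finset.filter_filter]
            refine Finset.sum_congr (Finset.filter_congr fun y _ => ?_) fun _ _ => rfl
            exact ⟨fun hy => hy.2, fun hy => ⟨by rw [hy]; exact hz, hy⟩⟩
        _ ≤ ∑ _z ∈ K, lam ^ 7 * μ (p (π x)) := Finset.sum_le_sum fun z hz => by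
            obtain ⟨hz, hzd⟩ := Finset.mem_filter.1 hz
            exact hbal z hz _ hxN (by rwa [dist_comm])
        _ = K.card * (lam ^ 7 * μ (p (π x))) := by simp
        _ ≤ lam ^ 5 * (lam ^ 7 * (lam ^ 7 * μ' (π x))) := by
            have := (hpos _ hxN).le
            gcongr
            exact hlow _ (hπ x).1
        _ = lam ^ 19 * μ' (π x) := by ring
        _ ≤ _ := by gcongr

theorem exists_pos_le_dist (P : Type*) [MetricSpace P] [Finite P] :
    ∃ δ : ℝ, 0 < δ ∧ ∀ x y : P, x ≠ y → δ ≤ dist x y := by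
  have hfin : {q : P × P | q.1 ≠ q.2}.Finite := Set.toFinite _
  rcases Set.eq_empty_or_nonempty {q : P × P | q.1 ≠ q.2} with he | hne
  · exact ⟨1, one_pos, fun x y hxy => absurd (show (x, y) ∈ {q : P × P | q.1 ≠ q.2} from hxy)
      (by simp [he])⟩
  · obtain ⟨q, hq, hmin⟩ := Set.exists_min_image _ (fun q : P × P => dist q.1 q.2) hfin hne
    exact ⟨dist q.1 q.2, dist_pos.2 hq, fun x y hxy => hmin (x, y) hxy⟩

theorem stmt13 :
    ∃ c : ℝ, 0 < c ∧
      ∀ (P : Type) [MetricSpace P] [Fintype P] [Nonempty P] (lam : ℝ),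
        IsDoubling P lam → 2 ≤ lam →
        ∃ μ : P → ℝ,
          (∀ x, 0 < μ x) ∧
          (∑ x : P, μ x) = 1 ∧
          ∀ (x : P) (r : ℝ), 0 < r →
            (∑ y ∈ Finset.univ.filter (fun y => dist x y ≤ 2 * r), μ y) ≤
              lam ^ c * ∑ y ∈ Finset.univ.filter (fun y => dist x y ≤ r), μ y := by
  classical
  refine ⟨19, by norm_num, fun P _ _ _ lam h hlam => ?_⟩
  obtain ⟨δ, hδ0, hδ⟩ := exists_pos_le_dist P
  obtain ⟨x₀⟩ := ‹Nonempty P›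
  obtain ⟨D, hD⟩ := (Metric.isBounded_iff.1 (Set.toFinite (Set.univ : Set P)).isBounded)
  have hD' : ∀ x y : P, dist x y ≤ D := fun x y => hD (Set.mem_univ x) (Set.mem_univ y)
  have hD0 : 0 ≤ D := dist_nonneg.trans (hD' x₀ x₀)
  have hlam1 : 1 ≤ lam := by linarith
  obtain ⟨n, hn⟩ := pow_unbounded_of_one_lt (8 * (D + 1) / δ) (by norm_num : (1 : ℝ) < 32)
  rw [div_lt_iff₀ hδ0, mul_comm _ δ] at hn
  have hnet : IsNet (D + 1) ({x₀} : Finset P) :=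
    ⟨by simp +contextual, fun x => ⟨x₀, by simp, by linarith [hD' x x₀]⟩⟩
  obtain ⟨ν, π, hν, hπ, hcell, hdoub⟩ := hnet.exists_doubling_extension h hlam1 hδ n
    (μ := fun _ => 1) (by linarith) hn (by simp) fun _ _ _ _ _ => by
      simpa using one_le_pow₀ hlam1
  have hπ0 : ∀ x, π x = x₀ := fun x => by simpa using (hπ x).1
  refine ⟨ν, hν, by simpa [hπ0] using hcell x₀, fun x r hr => ?_⟩
  have hpow : lam ^ (19 : ℝ) = lam ^ 19 := by exact_mod_cast Real.rpow_natCast lam 19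
  rw [hpow]
  rcases lt_or_ge r (4 * (D + 1)) with hrD | hrD
  · exact hdoub x r hr hrD
  · refine (Finset.sum_le_sum_of_subset_of_nonneg (fun y _ => ?_) fun y _ _ => (hν y).le).trans
      (le_mul_of_one_le_left (Finset.sum_nonneg fun y _ => (hν y).le) (one_le_pow₀ hlam1))
    simp only [Finset.mem_filter, Finset.mem_univ, true_and]
    linarith [hD' x y]
end

section
/- Let (P,d) be a finite metric space, α ≥ 1, and suppose μ : P → ℝ satisfies μ(x) > 0 for every x ∈ P and μ(B(x,2r)) ≤ α·μ(B(x,r)) for every x ∈ P and r > 0, where μ(S) := Σ_{y∈S} μ(y). Then for every x ∈ P and r > 0 there exist at most α⁵ points y₁, …, y_k ∈ P (k ≤ α⁵) such that B(x,2r) ⊆ ⋃_{i=1}^{k} B(y_i, r). In particular, P has doubling constant at most α⁵. -/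
/-- In a finite metric space, every set contains an `r`-separated subset which is an `r`-net. -/
theorem exists_separated_net {P : Type*} [MetricSpace P] (t : Finset P) {r : ℝ} (hr : 0 ≤ r) :
    ∃ s ⊆ t, (s : Set P).Pairwise (fun y z => r < dist y z) ∧
      ∀ y ∈ t, ∃ z ∈ s, dist z y ≤ r := by
  classical
  obtain ⟨s, hs, hmax⟩ := Finset.exists_max_image
    (t.powerset.filter fun s : Finset P => (s : Set P).Pairwise fun y z => r < dist y z)
    Finset.card ⟨∅, by simp⟩
  rw [Finset.mem_filter, Finset.mem_powerset] at hs
  refine ⟨s, hs.1, hs.2, fun y hy => ?_⟩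
  by_contra! hfar
  have hys : y ∉ s := fun h => by
    have := hfar y h
    rw [dist_self] at this
    linarith
  have hcard := hmax (insert y s) (by
    rw [Finset.mem_filter, Finset.mem_powerset, Finset.coe_insert]
    refine ⟨Finset.insert_subset hy hs.1, hs.2.insert fun z hz _ => ⟨?_, hfar z hz⟩⟩
    rw [dist_comm]
    exact hfar z hz)
  rw [Finset.card_insert_of_notMem hys] at hcard
  omega

/-- A measure that is `α`-doubling grows by a factor of at most `α ^ n` when the radius is
multiplied by `2 ^ n`. -/
theorem sum_ball_two_pow_mul_le {P : Type*} [MetricSpace P] [Fintype P]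
    {α : ℝ} (hα : 0 ≤ α) {μ : P → ℝ}
    (hdbl : ∀ (x : P) (r : ℝ), 0 < r →
      (∑ y ∈ Finset.univ.filter (fun y => dist x y ≤ 2 * r), μ y) ≤
        α * ∑ y ∈ Finset.univ.filter (fun y => dist x y ≤ r), μ y)
    (x : P) {r : ℝ} (hr : 0 < r) (n : ℕ) :
    (∑ y ∈ Finset.univ.filter (fun y => dist x y ≤ 2 ^ n * r), μ y) ≤
      α ^ n * ∑ y ∈ Finset.univ.filter (fun y => dist x y ≤ r), μ y := by
  induction n with
  | zero => simp
  | succ n ih =>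
    have h := hdbl x (2 ^ n * r) (by positivity)
    rw [← mul_assoc, ← pow_succ'] at h
    rw [pow_succ' α, mul_assoc]
    exact h.trans (mul_le_mul_of_nonneg_left ih hα)

/-- If `P` carries an `α`-doubling measure, then every ball of radius `2 * r` is covered by at most
`α ^ 4` balls of radius `r`. -/
theorem exists_cover_card_le_pow_four {P : Type*} [MetricSpace P] [Fintype P]
    {α : ℝ} (hα : 0 ≤ α) {μ : P → ℝ} (hμpos : ∀ x, 0 < μ x)
    (hdbl : ∀ (x : P) (r : ℝ), 0 < r →
      (∑ y ∈ Finset.univ.filter (fun y => dist x y ≤ 2 * r), μ y) ≤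
        α * ∑ y ∈ Finset.univ.filter (fun y => dist x y ≤ r), μ y)
    (x : P) {r : ℝ} (hr : 0 < r) :
    ∃ s : Finset P, (s.card : ℝ) ≤ α ^ 4 ∧
      ∀ y : P, dist x y ≤ 2 * r → ∃ z ∈ s, dist z y ≤ r := by
  classical
  obtain ⟨s, hst, hsep, hnet⟩ :=
    exists_separated_net (Finset.univ.filter fun y => dist x y ≤ 2 * r) hr.le
  refine ⟨s, ?_, fun y hy => hnet y (by simpa using hy)⟩
  set M := ∑ y ∈ Finset.univ.filter (fun y => dist x y ≤ 4 * r), μ y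
  have hsx : ∀ y ∈ s, dist x y ≤ 2 * r := fun y hy => by simpa using hst hy
  have hMpos : 0 < M := Finset.sum_pos (fun y _ => hμpos y) ⟨x, by simp [hr.le]⟩
  have hlower : ∀ y ∈ s, M ≤
      α ^ 4 * ∑ p ∈ Finset.univ.filter (fun p => dist y p ≤ r / 2), μ p := fun y hy => by
    refine le_trans ?_ (sum_ball_two_pow_mul_le hα hdbl y (half_pos hr) 4)
    refine Finset.sum_le_sum_of_subset_of_nonneg (fun p hp => ?_) fun p _ _ => (hμpos p).le
    rw [Finset.mem_filter] at hp ⊢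
    refine ⟨Finset.mem_univ p, ?_⟩
    linarith [hp.2, hsx y hy, dist_triangle_left y p x]
  have hupper : ∑ y ∈ s, ∑ p ∈ Finset.univ.filter (fun p => dist y p ≤ r / 2), μ p ≤ M := by
    rw [← Finset.sum_biUnion]
    · refine Finset.sum_le_sum_of_subset_of_nonneg (fun p hp => ?_) fun p _ _ => (hμpos p).le
      obtain ⟨y, hy, hyp⟩ := Finset.mem_biUnion.1 hp
      rw [Finset.mem_filter] at hyp ⊢
      refine ⟨Finset.mem_univ p, ?_⟩
      linarith [hyp.2, hsx y hy, dist_triangle x y p]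
    · intro y hy z hz hyz
      refine Finset.disjoint_left.2 fun p hp hq => ?_
      rw [Finset.mem_filter] at hp hq
      linarith [hp.2, hq.2, hsep hy hz hyz, dist_triangle_right y z p]
  refine le_of_mul_le_mul_right ?_ hMpos
  calc (s.card : ℝ) * M = ∑ y ∈ s, M := by simp
    _ ≤ ∑ y ∈ s, α ^ 4 * ∑ p ∈ Finset.univ.filter (fun p => dist y p ≤ r / 2), μ p :=
      Finset.sum_le_sum hlower
    _ = α ^ 4 * ∑ y ∈ s, ∑ p ∈ Finset.univ.filter (fun p => dist y p ≤ r / 2), μ p := by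
      rw [Finset.mul_sum]
    _ ≤ α ^ 4 * M := mul_le_mul_of_nonneg_left hupper (by positivity)

theorem stmt14 {P : Type*} [MetricSpace P] [Fintype P]
    (α : ℝ) (hα : 1 ≤ α) (μ : P → ℝ) (hμpos : ∀ x, 0 < μ x)
    (hdbl : ∀ (x : P) (r : ℝ), 0 < r →
      (∑ y ∈ Finset.univ.filter (fun y => dist x y ≤ 2 * r), μ y) ≤
        α * ∑ y ∈ Finset.univ.filter (fun y => dist x y ≤ r), μ y) :
    -- `B(x, 2r)` can be covered by at most `α ^ 5` balls of radius `r`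
    (∀ (x : P) (r : ℝ), 0 < r → ∃ s : Finset P, (s.card : ℝ) ≤ α ^ 5 ∧
        ∀ y : P, dist x y ≤ 2 * r → ∃ z ∈ s, dist z y ≤ r) ∧
    -- in particular, `P` has doubling constant at most `α ^ 5`
    (∀ (x : P) (r : ℝ), 0 < r → ∃ s : Finset P, (s.card : ℝ) ≤ α ^ 5 ∧
        ∀ y : P, dist x y ≤ r → ∃ z ∈ s, dist z y ≤ r / 2) := by
  have hcover : ∀ (x : P) (r : ℝ), 0 < r → ∃ s : Finset P, (s.card : ℝ) ≤ α ^ 5 ∧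
      ∀ y : P, dist x y ≤ 2 * r → ∃ z ∈ s, dist z y ≤ r := fun x r hr => by
    obtain ⟨s, hs, hcov⟩ :=
      exists_cover_card_le_pow_four (zero_le_one.trans hα) hμpos hdbl x hr
    exact ⟨s, hs.trans (pow_le_pow_right₀ hα (by norm_num)), hcov⟩
  refine ⟨hcover, fun x r hr => ?_⟩
  obtain ⟨s, hs, hcov⟩ := hcover x (r / 2) (half_pos hr)
  exact ⟨s, hs, fun y hy => hcov y (by linarith)⟩
end

section
/- Let d₂ ≥ 1 be an integer, let d₁ be a real number with 5·d₂ ≤ d₁, and let D > 1. Then there do not exist a norm ‖·‖_X on ℝ^{d₂} and a strictly increasing bijection f : [0,∞) → [0,∞) such that for every finite metric space (P,d) with doubling constant at most 2^{d₁} there is a map φ : P → ℝ^{d₂} satisfying d(x,y)/D ≤ f(‖φ(x) − φ(y)‖_X) ≤ d(x,y) for all x, y ∈ P. (In the paper's terminology: if d₂ ≤ d₁/5 then for every D > 1 no (d₁, D, d₂)-Assouad-type scheme exists.) -/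
/-- A function with the properties of a norm on `ℝ^k`, `k ≥ 1`, is equivalent to the sup norm. -/
theorem exists_bounds_of_norm_axioms {k : ℕ} (hk : 1 ≤ k) {ν : (Fin k → ℝ) → ℝ}
    (hν0 : ∀ x, 0 ≤ ν x) (hν : ∀ x, ν x = 0 ↔ x = 0)
    (hsmul : ∀ (a : ℝ) (x : Fin k → ℝ), ν (a • x) = |a| * ν x)
    (hadd : ∀ x y, ν (x + y) ≤ ν x + ν y) :
    ∃ c C : ℝ, 0 < c ∧ 0 < C ∧ ∀ x, c * ‖x‖ ≤ ν x ∧ ν x ≤ C * ‖x‖ := by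
  have : Nonempty (Fin k) := ⟨⟨0, hk⟩⟩
  let p : Seminorm ℝ (Fin k → ℝ) := Seminorm.of ν hadd (by simpa using hsmul)
  have hcont : Continuous p := p.convexOn.locallyLipschitz.continuous
  obtain ⟨u, hu, hmin⟩ := (isCompact_sphere (0 : Fin k → ℝ) 1).exists_isMinOn
    (NormedSpace.sphere_nonempty.2 zero_le_one) hcont.continuousOn
  obtain ⟨w, hw, hmax⟩ := (isCompact_sphere (0 : Fin k → ℝ) 1).exists_isMaxOn
    (NormedSpace.sphere_nonempty.2 zero_le_one) hcont.continuousOn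
  have hpos : ∀ v ∈ Metric.sphere (0 : Fin k → ℝ) 1, 0 < ν v := fun v hv ↦
    (hν0 v).lt_of_ne fun h ↦ by
      rw [(hν v).1 h.symm] at hv
      simp at hv
  refine ⟨ν u, ν w, hpos u hu, hpos w hw, fun x ↦ ?_⟩
  rcases eq_or_ne x 0 with rfl | hx
  · simp [(hν 0).2 rfl]
  have hx' : 0 < ‖x‖ := norm_pos_iff.2 hx
  have hmem : ‖x‖⁻¹ • x ∈ Metric.sphere (0 : Fin k → ℝ) 1 := by
    simp [norm_smul, hx'.ne']
  have hscale : ν x = ν (‖x‖⁻¹ • x) * ‖x‖ := by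
    rw [hsmul, abs_of_pos (inv_pos.2 hx')]
    field_simp
  rw [hscale]
  exact ⟨mul_le_mul_of_nonneg_right (hmin hmem) hx'.le,
    mul_le_mul_of_nonneg_right (hmax hmem) hx'.le⟩

theorem isDoubling_pi {ι P : Type*} [Fintype ι] [MetricSpace P] {n : ℕ}
    (h : IsDoubling P n) : IsDoubling (ι → P) ((n : ℝ) ^ Fintype.card ι) := by
  classical
  intro x r hr
  choose s hs hcover using fun i ↦ h (x i) r hr
  refine ⟨Fintype.piFinset s, ?_, fun y hy ↦ ?_⟩
  · rw [Fintype.card_piFinset]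
    push_cast
    exact (Finset.prod_le_prod (fun _ _ ↦ Nat.cast_nonneg _) fun i _ ↦ hs i).trans (by simp)
  · choose z hz hzy using fun i ↦ hcover i (y i) ((dist_le_pi_dist x y i).trans hy)
    exact ⟨z, Fintype.mem_piFinset.2 hz, (dist_pi_le_iff (by positivity)).2 hzy⟩

theorem isDoubling_int_Icc (N : ℕ) : IsDoubling (Set.Icc (0 : ℤ) N) (3 : ℕ) := by
  classical
  intro x r hr
  have h0N : (0 : ℤ) ≤ N := Int.natCast_nonneg N
  set q : ℤ := ⌊r / 2⌋ with hq
  have hq0 : 0 ≤ q := Int.floor_nonneg.2 (by positivity)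
  have hqr : (q : ℝ) ≤ r / 2 := Int.floor_le _
  have hrq : r / 2 < q + 1 := Int.lt_floor_add_one _
  refine ⟨{x, Set.projIcc 0 (N : ℤ) h0N (x + (2 * q + 1)),
    Set.projIcc 0 (N : ℤ) h0N (x - (2 * q + 1))}, by exact_mod_cast Finset.card_le_three,
    fun y hy ↦ ?_⟩
  have hclose : ∀ z : Set.Icc (0 : ℤ) N, |(z : ℤ) - y| ≤ q → dist z y ≤ r / 2 := fun z hz ↦ by
    rw [Subtype.dist_eq, Int.dist_eq]
    exact le_trans (by exact_mod_cast hz) hqr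
  have hxy : |(x : ℤ) - y| ≤ 2 * q + 1 := by
    rw [Subtype.dist_eq, Int.dist_eq] at hy
    have : |((x : ℤ) : ℝ) - (y : ℤ)| < ((2 * q + 2 : ℤ) : ℝ) := by
      push_cast
      linarith
    have : |(x : ℤ) - y| < 2 * q + 2 := by exact_mod_cast this
    omega
  have hy0 := y.2.1
  have hyN := y.2.2
  rw [abs_le] at hxy
  rcases lt_or_ge q ((y : ℤ) - x) with h | h
  · refine ⟨_, by simp, hclose (Set.projIcc 0 (N : ℤ) h0N (x + (2 * q + 1))) ?_⟩
    rw [Set.coe_projIcc, abs_le]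
    omega
  rcases lt_or_ge q ((x : ℤ) - y) with h' | h'
  · refine ⟨_, by simp, hclose (Set.projIcc 0 (N : ℤ) h0N (x - (2 * q + 1))) ?_⟩
    rw [Set.coe_projIcc, abs_le]
    omega
  · exact ⟨x, by simp, hclose x (by rw [abs_le]; omega)⟩

/-- A point of the integer grid `{0, …, N}^ι` is joined to the origin by a path of `N` steps of
length at most one, so a map whose displacement is at most `a` on pairs at distance at most one
has displacement at most `N * a` from the origin. -/
theorem displacement_le_of_grid {ι E : Type*} [Fintype ι] [AddGroup E] {ν : E → ℝ}
    (hν : ν 0 = 0) (hadd : ∀ x y, ν (x + y) ≤ ν x + ν y) {N : ℕ} {a : ℝ}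
    {φ : (ι → Set.Icc (0 : ℤ) N) → E} (hφ : ∀ x y, dist x y ≤ 1 → ν (φ x - φ y) ≤ a)
    (x : ι → Set.Icc (0 : ℤ) N) :
    ν (φ x - φ fun _ ↦ ⟨0, by simp⟩) ≤ N * a := by
  let path : ℕ → ι → Set.Icc (0 : ℤ) N := fun j i ↦
    ⟨min (x i) j, le_min (x i).2.1 (Int.natCast_nonneg j), (min_le_left _ _).trans (x i).2.2⟩
  have hstart : path 0 = fun _ ↦ ⟨0, by simp⟩ := by
    ext i
    simpa [path] using (x i).2.1
  have hend : path N = x := by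
    ext i
    simpa [path] using (x i).2.2
  have hstep : ∀ j, dist (path (j + 1)) (path j) ≤ 1 := fun j ↦ by
    refine (dist_pi_le_iff zero_le_one).2 fun i ↦ ?_
    rw [Subtype.dist_eq, Int.dist_eq]
    have : |min (x i : ℤ) ((j + 1 : ℕ) : ℤ) - min (x i : ℤ) (j : ℤ)| ≤ 1 := by
      rw [abs_le]
      omega
    exact_mod_cast this
  have hpath : ∀ j : ℕ, ν (φ (path j) - φ (path 0)) ≤ j * a := by
    intro j
    induction j with
    | zero => simp [hν]
    | succ j ih =>
      rw [← sub_add_sub_cancel (φ (path (j + 1))) (φ (path j)) (φ (path 0))]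
      push_cast
      linarith [hadd (φ (path (j + 1)) - φ (path j)) (φ (path j) - φ (path 0)),
        hφ _ _ (hstep j)]
  simpa only [hstart, hend] using hpath N

/-- At most `(2 * T + 1) ^ k` points of the sup-norm ball of radius `T * B` in `ℝ^k` are
pairwise at distance at least `B`. -/
theorem card_le_of_separated {P : Type*} [Fintype P] {k T : ℕ} {B : ℝ} (hB : 0 < B)
    (ψ : P → Fin k → ℝ) (hbound : ∀ x, ‖ψ x‖ ≤ T * B)
    (hsep : ∀ x y, x ≠ y → B ≤ ‖ψ x - ψ y‖) :
    Fintype.card P ≤ (2 * T + 1) ^ k := by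
  classical
  have hcoord : ∀ x i, |ψ x i / B| ≤ T := fun x i ↦ by
    rw [abs_div, abs_of_pos hB, div_le_iff₀ hB]
    exact (norm_le_pi_norm (ψ x) i).trans (hbound x)
  let F : P → Fin k → Set.Icc (-T : ℤ) T := fun x i ↦
    ⟨⌊ψ x i / B⌋, Int.le_floor.2 (by simpa using (abs_le.1 (hcoord x i)).1),
      by exact_mod_cast (Int.floor_le (ψ x i / B)).trans (abs_le.1 (hcoord x i)).2⟩
  have hF : Function.Injective F := by
    intro x y hxy
    by_contra hne
    refine (hsep x y hne).not_gt ((pi_norm_lt_iff hB).2 fun i ↦ ?_)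
    have hfloor : ⌊ψ x i / B⌋ = ⌊ψ y i / B⌋ := congrArg Subtype.val (congrFun hxy i)
    have := Int.abs_sub_lt_one_of_floor_eq_floor hfloor
    rwa [← sub_div, abs_div, abs_of_pos hB, div_lt_one hB] at this
  refine (Fintype.card_le_of_injective F hF).trans_eq ?_
  rw [Fintype.card_fun, Fintype.card_fin, Fintype.card_ofFinset, Int.card_Icc]
  congr 1
  omega

theorem three_pow_succ_le_two_rpow {k : ℕ} (hk : 1 ≤ k) {d : ℝ} (hd : 5 * (k : ℝ) ≤ d) :
    (3 : ℝ) ^ (k + 1) ≤ 2 ^ d :=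
  calc (3 : ℝ) ^ (k + 1) ≤ 3 ^ (2 * k) := pow_le_pow_right₀ (by norm_num) (by omega)
    _ = 9 ^ k := by rw [pow_mul]; norm_num
    _ ≤ 32 ^ k := pow_le_pow_left₀ (by norm_num) (by norm_num) k
    _ = 2 ^ (5 * k) := by rw [pow_mul]; norm_num
    _ = (2 : ℝ) ^ (5 * (k : ℝ)) := by rw [← Real.rpow_natCast]; push_cast; rfl
    _ ≤ 2 ^ d := Real.rpow_le_rpow_of_exponent_le (by norm_num) hd

/-- If `d₂ ≤ d₁ / 5` then, for every `D > 1`, no `(d₁, D, d₂)`-Assouad-type scheme exists: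
there is no norm `ν` on `ℝ^{d₂}` and strictly increasing bijection `f` of `[0,∞)` such that
every finite metric space of doubling dimension at most `d₁` (doubling constant at most
`2 ^ d₁`) admits a map `φ` into `(ℝ^{d₂}, ν)` with
`d(x,y) / D ≤ f (ν (φ x - φ y)) ≤ d(x,y)`. -/
theorem stmt15 (d₂ : ℕ) (hd₂ : 1 ≤ d₂) (d₁ D : ℝ)
    (hdim : 5 * (d₂ : ℝ) ≤ d₁) (hD : 1 < D) :
    ¬ ∃ (ν : (Fin d₂ → ℝ) → ℝ) (f : ℝ → ℝ),
        (∀ x, 0 ≤ ν x) ∧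
        (∀ x, ν x = 0 ↔ x = 0) ∧
        (∀ (a : ℝ) (x : Fin d₂ → ℝ), ν (a • x) = |a| * ν x) ∧
        (∀ x y, ν (x + y) ≤ ν x + ν y) ∧
        StrictMonoOn f (Set.Ici 0) ∧
        Set.BijOn f (Set.Ici 0) (Set.Ici 0) ∧
        ∀ (P : Type) [MetricSpace P] [Fintype P],
          IsDoubling P ((2 : ℝ) ^ d₁) →
          ∃ φ : P → (Fin d₂ → ℝ), ∀ x y : P,
            dist x y / D ≤ f (ν (φ x - φ y)) ∧ f (ν (φ x - φ y)) ≤ dist x y := by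
  rintro ⟨ν, f, hν0, hν, hsmul, hadd, hf, hbij, hemb⟩
  obtain ⟨c, C, hc, hC, hcC⟩ := exists_bounds_of_norm_axioms hd₂ hν0 hν hsmul hadd
  have hD0 : 0 < D := by linarith
  obtain ⟨a, ha0, ha⟩ := hbij.surjOn (show (1 : ℝ) ∈ Set.Ici 0 from Set.mem_Ici.2 zero_le_one)
  obtain ⟨b, hb0, hb⟩ := hbij.surjOn (show 1 / D ∈ Set.Ici 0 from by simp [hD0.le])
  obtain ⟨e, he0, he⟩ := hbij.surjOn (show (0 : ℝ) ∈ Set.Ici 0 from Set.mem_Ici.2 le_rfl)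
  have hbpos : 0 < b := lt_of_le_of_lt he0
    ((hf.lt_iff_lt he0 hb0).1 (by rw [he, hb]; positivity))
  have hB : 0 < b / C := by positivity
  obtain ⟨K, hK⟩ := exists_nat_ge (a / c / (b / C))
  rw [div_le_iff₀ hB] at hK
  set N : ℕ := (2 * K + 1) ^ d₂ with hN
  have hN1 : 1 ≤ N := Nat.one_le_pow _ _ (by omega)
  have hdoub : IsDoubling (Fin (d₂ + 1) → Set.Icc (0 : ℤ) N) (2 ^ d₁) := fun x r hr ↦ by
    obtain ⟨s, hs, hcover⟩ := isDoubling_pi (ι := Fin (d₂ + 1)) (isDoubling_int_Icc N) x r hr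
    refine ⟨s, hs.trans ?_, hcover⟩
    simpa using three_pow_succ_le_two_rpow hd₂ hdim
  obtain ⟨φ, hφ⟩ := hemb _ hdoub
  have hclose : ∀ x y, dist x y ≤ 1 → ν (φ x - φ y) ≤ a := fun x y hxy ↦
    (hf.le_iff_le (hν0 _) ha0).1 (by rw [ha]; exact (hφ x y).2.trans hxy)
  have hfar : ∀ x y, x ≠ y → b ≤ ν (φ x - φ y) := fun x y hxy ↦ by
    refine (hf.le_iff_le hb0 (hν0 _)).1 (le_trans ?_ (hφ x y).1)
    rw [hb]
    obtain ⟨i, hi⟩ := Function.ne_iff.1 hxy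
    have : 1 ≤ dist x y := by
      refine le_trans ?_ (dist_le_pi_dist x y i)
      exact Int.pairwise_one_le_dist fun h ↦ hi (Subtype.ext h)
    gcongr
  have hcard := card_le_of_separated (T := N * K) hB (fun x ↦ φ x - φ fun _ ↦ ⟨0, by simp⟩)
    (fun x ↦ by
      have h₁ := displacement_le_of_grid ((hν 0).2 rfl) hadd hclose x
      have h₂ := (hcC (φ x - φ fun _ ↦ ⟨0, by simp⟩)).1
      have h₃ : ‖φ x - φ fun _ ↦ ⟨0, by simp⟩‖ ≤ N * (a / c) := by
        rw [← mul_div_assoc, le_div_iff₀ hc]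
        linarith
      refine h₃.trans ?_
      push_cast
      rw [mul_assoc]
      gcongr)
    (fun x y hxy ↦ by
      rw [sub_sub_sub_cancel_right, div_le_iff₀' hC]
      exact (hfar x y hxy).trans (hcC _).2)
  rw [Fintype.card_fun, Fintype.card_fin, Fintype.card_ofFinset, Int.card_Icc] at hcard
  have hlt : (2 * (N * K) + 1) ^ d₂ < (N + 1) ^ (d₂ + 1) :=
    calc (2 * (N * K) + 1) ^ d₂ ≤ (N * (2 * K + 1)) ^ d₂ := Nat.pow_le_pow_left (by nlinarith) _
      _ = N ^ (d₂ + 1) := by rw [mul_pow, ← hN, pow_succ]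
      _ < (N + 1) ^ (d₂ + 1) := Nat.pow_lt_pow_left (by omega) (by omega)
  have : ((N : ℤ) + 1 - 0).toNat = N + 1 := by omega
  rw [this] at hcard
  omega
end

section
/- Let k ≥ 1 be an integer and 0 < η ≤ 0.1. Let P ⊆ S^k be an η-net of the unit sphere S^k = {x ∈ ℝ^{k+1} : ‖x‖₂ = 1}, i.e., for every x ∈ S^k there exists p ∈ P with ‖x − p‖₂ ≤ η. Suppose φ : P → ℝ^{k} and a ≥ 1 satisfy ‖x − y‖₂/a ≤ ‖φ(x) − φ(y)‖₂ ≤ ‖x − y‖₂ for all x, y ∈ P. Then a ≥ (1−η)/η. (Any embedding of a sufficiently dense net of the k-sphere into k-dimensional Euclidean space has distortion at least Ω(1/η).) -/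
open MeasureTheory Metric Set Module
open scoped RealInnerProductSpace

/-- The value at `1` of the polynomial `t ↦ det (1 + t • A)` is a linear combination of its values
at the points of `T`, with coefficients not depending on `A`. -/
lemma exists_coeff_det_one_add {E : Type*} [AddCommGroup E] [Module ℝ E] [FiniteDimensional ℝ E]
    (T : Finset ℝ) (hT : finrank ℝ E < T.card) :
    ∃ c : ℝ → ℝ, ∑ t ∈ T, c t = 1 ∧ ∀ A : E →ₗ[ℝ] E,
      LinearMap.det (1 + A) = ∑ t ∈ T, c t * LinearMap.det (1 + t • A) := by
  classical
  have hinj : Set.InjOn (id : ℝ → ℝ) T := Function.injective_id.injOn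
  have hne : T.Nonempty := Finset.card_pos.1 (by lia)
  refine ⟨fun t => (Lagrange.basis T id t).eval 1, ?_, fun A => ?_⟩
  · rw [← Polynomial.eval_finsetSum, Lagrange.sum_basis hinj hne, Polynomial.eval_one]
  · let b := finBasis ℝ E
    let M := LinearMap.toMatrix b b A
    let p := Matrix.det ((Polynomial.X : Polynomial ℝ) • M.map Polynomial.C +
      (1 : Matrix _ _ ℝ).map Polynomial.C)
    have hp : ∀ t : ℝ, p.eval t = LinearMap.det (1 + t • A) := by
      intro t
      have hM : LinearMap.toMatrix b b (1 + t • A) = 1 + t • M := by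
        rw [map_add, map_smul, LinearMap.toMatrix_one]
      rw [← LinearMap.det_toMatrix b, hM, ← Polynomial.coe_evalRingHom, RingHom.map_det]
      congr 1
      ext i j
      rcases eq_or_ne i j with rfl | hij
      · simp [M, add_comm, mul_comm t]
      · simp [M, hij, mul_comm t]
    have hdeg : p.degree < T.card := by
      refine lt_of_le_of_lt Polynomial.degree_le_natDegree ?_
      have := Polynomial.natDegree_det_X_add_C_le M 1
      rw [Fintype.card_fin] at this
      exact_mod_cast lt_of_le_of_lt this hT
    have h1 := congrArg (Polynomial.eval 1) (Lagrange.eq_interpolate hinj hdeg)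
    rw [hp, one_smul, Lagrange.interpolate_apply, Polynomial.eval_finsetSum] at h1
    rw [h1]
    refine Finset.sum_congr rfl fun t _ => ?_
    rw [Polynomial.eval_mul, Polynomial.eval_C, id, hp, mul_comm]

lemma det_one_add_pos_of_norm_lt_one {E : Type*} [NormedAddCommGroup E] [NormedSpace ℝ E]
    [FiniteDimensional ℝ E] (A : E →L[ℝ] E) (hA : ‖A‖ < 1) : 0 < (1 + A).det := by
  have hne : ∀ s ∈ Icc (0 : ℝ) 1, (1 + s • A).det ≠ 0 := by
    intro s hs h0
    obtain ⟨v, hv, hv0⟩ := (LinearMap.bot_lt_ker_of_det_eq_zero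
      (f := ((1 + s • A : E →L[ℝ] E) : E →ₗ[ℝ] E)) h0).ne' |> Submodule.exists_mem_ne_zero_of_ne_bot
    have hv' : v + s • A v = 0 := by simpa using hv
    have h1 : ‖v‖ ≤ ‖A‖ * ‖v‖ := by
      calc ‖v‖ = ‖s • A v‖ := by rw [← norm_neg, neg_eq_of_add_eq_zero_right hv']
        _ = s * ‖A v‖ := by rw [norm_smul, Real.norm_of_nonneg hs.1]
        _ ≤ 1 * ‖A v‖ := by gcongr; exact hs.2
        _ ≤ ‖A‖ * ‖v‖ := by rw [one_mul]; exact A.le_opNorm v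
    nlinarith [norm_pos_iff.2 hv0]
  have hcont : Continuous fun s : ℝ => (1 + s • A).det :=
    ContinuousLinearMap.continuous_det.comp (by fun_prop)
  by_contra! hneg
  obtain ⟨s, hs, hs0⟩ := intermediate_value_Icc' (zero_le_one (α := ℝ)) hcont.continuousOn
    (show (0 : ℝ) ∈ Icc _ _ from ⟨by simpa using hneg, by simp [ContinuousLinearMap.det]⟩)
  exact hne s hs hs0

section

variable {E : Type*} [NormedAddCommGroup E] [InnerProductSpace ℝ E] [FiniteDimensional ℝ E]

lemma integral_det_one_add_smul_fderiv [MeasurableSpace E] [BorelSpace E] {r : E → E}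
    (hr : ∀ x ∈ closedBall (0 : E) 1, ContDiffAt ℝ 1 r x)
    (hmaps : ∀ x ∈ closedBall (0 : E) 1, ‖r x‖ = 1)
    (hfix : ∀ x ∈ sphere (0 : E) 1, r x = x) {K : NNReal}
    (hK : LipschitzOnWith K (fun x => r x - x) (closedBall (0 : E) 1))
    {t : ℝ} (ht0 : 0 ≤ t) (ht1 : t < 1) (htK : t * K < 1) :
    ∫ x in ball (0 : E) 1, (1 + t • (fderiv ℝ r x - 1)).det = volume.real (ball (0 : E) 1) := by
  set f : E → E := fun x => x + t • (r x - x) with hf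
  have hder : ∀ x ∈ ball (0 : E) 1, HasStrictFDerivAt f (1 + t • (fderiv ℝ r x - 1)) x := by
    intro x hx
    have h1 := (hr x (ball_subset_closedBall hx)).hasStrictFDerivAt one_ne_zero
    exact (hasStrictFDerivAt_id x).add ((h1.sub (hasStrictFDerivAt_id x)).const_smul t)
  have hdet : ∀ x ∈ ball (0 : E) 1, 0 < (1 + t • (fderiv ℝ r x - 1)).det := by
    intro x hx
    apply det_one_add_pos_of_norm_lt_one
    have h1 := ((hr x (ball_subset_closedBall hx)).hasStrictFDerivAt
      one_ne_zero).hasFDerivAt.sub (hasFDerivAt_id x)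
    have h2 : ‖fderiv ℝ r x - 1‖ ≤ K :=
      h1.le_of_lipschitzOn (Filter.mem_of_superset (isOpen_ball.mem_nhds hx)
        ball_subset_closedBall) hK
    rw [norm_smul, Real.norm_of_nonneg ht0]
    exact lt_of_le_of_lt (by gcongr) htK
  have hinj : InjOn f (closedBall 0 1) := by
    intro x hx y hy hxy
    have h1 := hK.norm_sub_le hx hy
    have h2 : x - y = -(t • ((r x - x) - (r y - y))) := by
      have : x + t • (r x - x) = y + t • (r y - y) := hxy
      rw [← sub_eq_zero] at this ⊢
      rw [← this]
      module
    have h3 : ‖x - y‖ ≤ t * (K * ‖x - y‖) := by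
      conv_lhs => rw [h2, norm_neg, norm_smul, Real.norm_of_nonneg ht0]
      gcongr
    by_contra hne
    have := norm_pos_iff.2 (sub_ne_zero.2 hne)
    nlinarith
  have hnorm : ∀ x ∈ closedBall (0 : E) 1, ‖f x‖ ≤ (1 - t) * ‖x‖ + t := by
    intro x hx
    calc ‖f x‖ = ‖(1 - t) • x + t • r x‖ := by congr 1; simp only [hf]; module
      _ ≤ ‖(1 - t) • x‖ + ‖t • r x‖ := norm_add_le _ _
      _ = (1 - t) * ‖x‖ + t := by
        rw [norm_smul, norm_smul, hmaps x hx, Real.norm_of_nonneg ht0,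
          Real.norm_of_nonneg (by linarith), mul_one]
  have himg_sub : f '' ball 0 1 ⊆ ball 0 1 := by
    rintro _ ⟨x, hx, rfl⟩
    have := hnorm x (ball_subset_closedBall hx)
    rw [mem_ball_zero_iff] at hx ⊢
    nlinarith
  have hopen : IsOpen (f '' ball 0 1) := by
    rw [isOpen_iff_mem_nhds]
    rintro _ ⟨x, hx, rfl⟩
    have h1 := hder x hx
    rw [← ContinuousLinearMap.coe_toContinuousLinearEquivOfDetNeZero _ (hdet x hx).ne'] at h1
    rw [← h1.map_nhds_eq_of_equiv]
    exact Filter.image_mem_map (isOpen_ball.mem_nhds hx)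
  have hcont : ContinuousOn f (closedBall 0 1) := fun x hx =>
    ((continuousAt_id).add (((hr x hx).continuousAt.sub continuousAt_id).const_smul
      t)).continuousWithinAt
  have himg : f '' ball 0 1 = ball 0 1 := by
    refine himg_sub.antisymm
      ((convex_ball (0 : E) 1).isPreconnected.subset_of_closure_inter_subset hopen ?_ ?_)
    · refine ⟨f 0, himg_sub ⟨0, by simp, rfl⟩, 0, by simp, rfl⟩
    · rintro y ⟨hy, hyb⟩
      have hcl : IsClosed (f '' closedBall 0 1) :=
        ((isCompact_closedBall 0 1).image_of_continuousOn hcont).isClosed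
      obtain ⟨x, hx, rfl⟩ := closure_minimal (image_mono ball_subset_closedBall) hcl hy
      refine ⟨x, ?_, rfl⟩
      rw [mem_closedBall_zero_iff] at hx
      rw [mem_ball_zero_iff] at hyb ⊢
      refine lt_of_le_of_ne hx fun h1 => ?_
      have : f x = x := by simp [hf, hfix x (by simpa using h1)]
      rw [this] at hyb
      exact hyb.ne h1
  have key := integral_image_eq_integral_abs_det_fderiv_smul volume measurableSet_ball
    (fun x hx => (hder x hx).hasFDerivAt.hasFDerivWithinAt)
    (hinj.mono ball_subset_closedBall) (fun _ => (1 : ℝ))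
  rw [himg] at key
  simp only [integral_const, smul_eq_mul, mul_one, MeasurableSet.univ, measureReal_restrict_apply,
    univ_inter] at key
  rw [key]
  exact setIntegral_congr_fun measurableSet_ball fun x hx => (abs_of_pos (hdet x hx)).symm

/-- There is no `C¹` retraction of the closed unit ball onto the unit sphere. -/
theorem not_exists_contDiff_retraction {r : E → E}
    (hr : ∀ x ∈ closedBall (0 : E) 1, ContDiffAt ℝ 1 r x)
    (hmaps : ∀ x ∈ closedBall (0 : E) 1, ‖r x‖ = 1)
    (hfix : ∀ x ∈ sphere (0 : E) 1, r x = x) : False := by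
  borelize E
  have hrOn : ContDiffOn ℝ 1 r (closedBall 0 1) := fun x hx => (hr x hx).contDiffWithinAt
  obtain ⟨K, hK⟩ := (hrOn.sub contDiffOn_id).exists_lipschitzOnWith one_ne_zero
    (convex_closedBall (0 : E) 1) (isCompact_closedBall 0 1)
  obtain ⟨T, hTs, hTc⟩ := (Ioo_infinite (show (0 : ℝ) < 1 / (K + 1) by
    positivity)).exists_subset_card_eq (finrank ℝ E + 1)
  obtain ⟨c, hc, hcdet⟩ := exists_coeff_det_one_add (E := E) T (by lia)
  have hint : ∀ t ∈ T, ∫ x in ball (0 : E) 1, (1 + t • (fderiv ℝ r x - 1)).det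
      = volume.real (ball (0 : E) 1) := by
    intro t ht
    obtain ⟨h0, h1⟩ := hTs ht
    rw [lt_div_iff₀ (by positivity)] at h1
    have : 0 ≤ t * K := by positivity
    exact integral_det_one_add_smul_fderiv hr hmaps hfix hK h0.le (by linarith) (by linarith)
  have hinteg : ∀ t : ℝ, IntegrableOn (fun x => (1 + t • (fderiv ℝ r x - 1)).det)
      (ball (0 : E) 1) := by
    intro t
    refine IntegrableOn.mono_set (ContinuousOn.integrableOn_compact (isCompact_closedBall 0 1) ?_)
      ball_subset_closedBall
    intro x hx
    have h1 : ContinuousAt (fderiv ℝ r) x :=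
      ((hr x hx).fderiv_right (m := 0) (by simp)).continuousAt
    exact (ContinuousLinearMap.continuous_det.continuousAt.comp
      (continuousAt_const.add ((h1.sub continuousAt_const).const_smul t))).continuousWithinAt
  have hzero : ∀ x ∈ ball (0 : E) 1, (fderiv ℝ r x).det = 0 := by
    intro x hx
    have hxc := ball_subset_closedBall hx
    have h1 : HasFDerivAt r (fderiv ℝ r x) x :=
      ((hr x hxc).differentiableAt one_ne_zero).hasFDerivAt
    have h2 := h1.norm_sq
    have h3 : (fun y => ‖r y‖ ^ 2) =ᶠ[nhds x] fun _ => (1 : ℝ) := by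
      filter_upwards [isOpen_ball.mem_nhds hx] with y hy
      rw [hmaps y (ball_subset_closedBall hy), one_pow]
    have h4 := h2.unique ((hasFDerivAt_const (1 : ℝ) x).congr_of_eventuallyEq h3)
    by_contra hne
    obtain ⟨u, hu⟩ := ((fderiv ℝ r x).toContinuousLinearEquivOfDetNeZero hne).surjective (r x)
    have hu' : fderiv ℝ r x u = r x := hu
    have h5 := DFunLike.congr_fun h4 u
    simp [hu', hmaps x hxc] at h5
  have hfinal : ∫ x in ball (0 : E) 1, (fderiv ℝ r x).det = volume.real (ball (0 : E) 1) := by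
    have h1 : ∀ x, (fderiv ℝ r x).det =
        ∑ t ∈ T, c t * (1 + t • (fderiv ℝ r x - 1)).det := by
      intro x
      have := hcdet ((fderiv ℝ r x - 1 : E →L[ℝ] E) : E →ₗ[ℝ] E)
      simpa [ContinuousLinearMap.det] using this
    simp_rw [h1]
    rw [integral_finsetSum _ fun t _ => (hinteg t).const_mul _]
    simp_rw [integral_const_mul]
    rw [Finset.sum_congr rfl fun t ht => by rw [hint t ht], ← Finset.sum_mul, hc, one_mul]
  rw [setIntegral_congr_fun measurableSet_ball hzero] at hfinal
  have hpos : 0 < volume.real (ball (0 : E) 1) :=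
    ENNReal.toReal_pos (measure_ball_pos _ _ one_pos).ne' measure_ball_lt_top.ne
  simp only [integral_zero] at hfinal
  exact hpos.ne hfinal

/-- A `C¹` vector field pointing outwards along the unit sphere has a zero. -/
theorem exists_eq_zero_of_inner_pos {v : E → E} (hv : ContDiff ℝ 1 v)
    (hpos : ∀ x ∈ sphere (0 : E) 1, 0 < ⟪x, v x⟫) : ∃ x, v x = 0 := by
  by_contra! hne
  have hvpos : ∀ x, 0 < ‖v x‖ ^ 2 := fun x => by have := norm_pos_iff.2 (hne x); positivity
  set q : E → ℝ := fun x => ⟪x, v x⟫ ^ 2 + ‖v x‖ ^ 2 * (1 - ‖x‖ ^ 2) with hq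
  have hqpos : ∀ x ∈ closedBall (0 : E) 1, 0 < q x := by
    intro x hx
    rw [mem_closedBall_zero_iff] at hx
    rcases hx.lt_or_eq with h | h
    · have h1 : 0 < 1 - ‖x‖ ^ 2 := by nlinarith [norm_nonneg x]
      have := mul_pos (hvpos x) h1
      simp only [hq]
      positivity
    · have := hpos x (by simpa using h)
      simp only [hq, h]
      simp only [one_pow, sub_self, mul_zero, add_zero]
      positivity
  have hqd : ContDiff ℝ 1 q := by
    have h1 : ContDiff ℝ 1 fun x => ⟪x, v x⟫ := contDiff_id.inner ℝ hv
    exact (h1.pow 2).add ((hv.norm_sq ℝ).mul (contDiff_const.sub (contDiff_id.norm_sq ℝ)))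
  set s : E → ℝ := fun x => (-⟪x, v x⟫ + √(q x)) / ‖v x‖ ^ 2 with hs
  refine not_exists_contDiff_retraction (r := fun x => x + s x • v x) ?_ ?_ ?_
  · intro x hx
    have h1 : ContDiffAt ℝ 1 (fun x => ⟪x, v x⟫) x := (contDiff_id.inner ℝ hv).contDiffAt
    have h2 : ContDiffAt ℝ 1 (fun x => √(q x)) x := hqd.contDiffAt.sqrt (hqpos x hx).ne'
    exact contDiffAt_id.add (((h1.neg.add h2).div (hv.norm_sq ℝ).contDiffAt
      (hvpos x).ne').smul hv.contDiffAt)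
  · intro x hx
    have h1 : s x * ‖v x‖ ^ 2 = -⟪x, v x⟫ + √(q x) := div_mul_cancel₀ _ (hvpos x).ne'
    have h2 : √(q x) ^ 2 = q x := Real.sq_sqrt (hqpos x hx).le
    have h3 : ‖x + s x • v x‖ ^ 2 = ‖x‖ ^ 2 + 2 * (s x * ⟪x, v x⟫) + s x ^ 2 * ‖v x‖ ^ 2 := by
      rw [norm_add_sq_real, inner_smul_right, norm_smul, mul_pow, Real.norm_eq_abs, sq_abs]
    have h4 : ‖x + s x • v x‖ ^ 2 = 1 := by
      rw [h3]
      apply mul_left_cancel₀ (hvpos x).ne'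
      simp only [hq] at h2
      linear_combination (s x * ‖v x‖ ^ 2 + ⟪x, v x⟫ + √(q x)) * h1 + h2
    exact (pow_eq_one_iff_of_nonneg (norm_nonneg _) two_ne_zero).1 h4
  · intro x hx
    have h1 := hpos x hx
    have h2 : s x = 0 := by
      simp only [hs, hq, mem_sphere_zero_iff_norm.1 hx]
      rw [one_pow, sub_self, mul_zero, add_zero, Real.sqrt_sq h1.le]
      simp
    simp [h2]

end

section

variable {ι V : Type*} [NormedAddCommGroup V] [InnerProductSpace ℝ V]

lemma sum_mul_norm_sub_sq_eq (s : Finset ι) (w : ι → ℝ) (hw : ∑ i ∈ s, w i = 1)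
    (y : ι → V) (z : V) :
    ∑ i ∈ s, w i * ‖y i - z‖ ^ 2 =
      ∑ i ∈ s, w i * ‖y i - ∑ j ∈ s, w j • y j‖ ^ 2 + ‖∑ j ∈ s, w j • y j - z‖ ^ 2 := by
  set m := ∑ j ∈ s, w j • y j with hm
  have h1 : ∀ i, w i * ‖y i - z‖ ^ 2 = w i * ‖y i - m‖ ^ 2 + 2 * ⟪w i • y i - w i • m, m - z⟫ +
      w i * ‖m - z‖ ^ 2 := by
    intro i
    rw [← sub_add_sub_cancel (y i) m z, norm_add_sq_real, ← smul_sub, real_inner_smul_left]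
    ring
  simp_rw [h1, Finset.sum_add_distrib, ← Finset.mul_sum, ← sum_inner, Finset.sum_sub_distrib,
    ← Finset.sum_smul, ← Finset.sum_mul, hw, ← hm]
  simp

lemma sum_sum_mul_norm_sub_sq (s : Finset ι) (w : ι → ℝ) (hw : ∑ i ∈ s, w i = 1) (y : ι → V) :
    ∑ j ∈ s, w j * ∑ i ∈ s, w i * ‖y i - y j‖ ^ 2 =
      2 * ∑ i ∈ s, w i * ‖y i - ∑ j ∈ s, w j • y j‖ ^ 2 := by
  simp_rw [sum_mul_norm_sub_sq_eq s w hw y (y _), mul_add, Finset.sum_add_distrib,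
    ← Finset.sum_mul, hw, norm_sub_rev (∑ j ∈ s, w j • y j)]
  ring

/-- The variance of a weighted family does not increase under maps that shrink distances. -/
lemma sum_mul_norm_sub_mean_sq_le {W : Type*} [NormedAddCommGroup W] [InnerProductSpace ℝ W]
    (s : Finset ι) (w : ι → ℝ) (hw0 : ∀ i ∈ s, 0 ≤ w i) (hw : ∑ i ∈ s, w i = 1)
    (y : ι → V) (u : ι → W) (h : ∀ i ∈ s, ∀ j ∈ s, ‖u i - u j‖ ≤ ‖y i - y j‖) (z : V) :
    ∑ i ∈ s, w i * ‖u i - ∑ j ∈ s, w j • u j‖ ^ 2 ≤ ∑ i ∈ s, w i * ‖y i - z‖ ^ 2 := by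
  have h1 : ∑ j ∈ s, w j * ∑ i ∈ s, w i * ‖u i - u j‖ ^ 2 ≤
      ∑ j ∈ s, w j * ∑ i ∈ s, w i * ‖y i - y j‖ ^ 2 :=
    Finset.sum_le_sum fun j hj => mul_le_mul_of_nonneg_left (Finset.sum_le_sum fun i hi =>
      mul_le_mul_of_nonneg_left (pow_le_pow_left₀ (norm_nonneg _) (h i hi j hj) 2) (hw0 i hi))
      (hw0 j hj)
  rw [sum_sum_mul_norm_sub_sq s w hw, sum_sum_mul_norm_sub_sq s w hw] at h1
  rw [sum_mul_norm_sub_sq_eq s w hw y z]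
  nlinarith [sq_nonneg ‖∑ j ∈ s, w j • y j - z‖]

end

section

variable {E F : Type*} [NormedAddCommGroup E] [InnerProductSpace ℝ E]
  [NormedAddCommGroup F] [InnerProductSpace ℝ F]

lemma inner_pos_of_norm_sub_mean_lt {s : Finset E} (hs : ∀ p ∈ s, ‖p‖ = 1) {φ : E → F}
    {a ρ : ℝ} (hlow : ∀ p ∈ s, ∀ q ∈ s, ‖p - q‖ ≤ a * ‖φ p - φ q‖)
    (hup : ∀ p ∈ s, ∀ q ∈ s, ‖φ p - φ q‖ ≤ ‖p - q‖)
    {w : E → ℝ} (hw0 : ∀ p ∈ s, 0 ≤ w p) (hw : ∑ p ∈ s, w p = 1) {x : E}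
    (hx : ∀ p ∈ s, w p ≠ 0 → ‖x - p‖ ≤ ρ) {q : E} (hq : q ∈ s)
    (hlt : a ^ 2 * (ρ ^ 2 + ‖∑ p ∈ s, w p • φ p - φ q‖ ^ 2) < 2 * (1 - ρ)) : 0 < ⟪x, q⟫ := by
  have hV : ∑ p ∈ s, w p * ‖φ p - φ q‖ ^ 2 ≤ ρ ^ 2 + ‖∑ p ∈ s, w p • φ p - φ q‖ ^ 2 := by
    rw [sum_mul_norm_sub_sq_eq s w hw]
    gcongr
    refine (sum_mul_norm_sub_mean_sq_le s w hw0 hw id φ hup x).trans ?_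
    calc ∑ p ∈ s, w p * ‖id p - x‖ ^ 2 ≤ ∑ p ∈ s, w p * ρ ^ 2 := by
          refine Finset.sum_le_sum fun p hp => ?_
          rcases eq_or_ne (w p) 0 with h | h
          · simp [h]
          · have := hw0 p hp
            rw [id, norm_sub_rev]
            gcongr
            exact hx p hp h
      _ = ρ ^ 2 := by rw [← Finset.sum_mul, hw, one_mul]
  have hterm : ∀ p ∈ s, w p * (1 - ρ) - a ^ 2 / 2 * (w p * ‖φ p - φ q‖ ^ 2) ≤ w p * ⟪x, q⟫ := by
    intro p hp
    rcases eq_or_ne (w p) 0 with h | h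
    · simp [h]
    have h1 : ⟪p, q⟫ = 1 - ‖p - q‖ ^ 2 / 2 := by
      have := norm_sub_sq_real p q
      rw [hs p hp, hs q hq] at this
      linarith
    have h2 : ‖p - q‖ ^ 2 ≤ (a * ‖φ p - φ q‖) ^ 2 := by
      gcongr
      exact hlow p hp q hq
    have h3 : -ρ ≤ ⟪x - p, q⟫ := by
      have := abs_real_inner_le_norm (x - p) q
      rw [hs q hq, mul_one] at this
      linarith [neg_abs_le ⟪x - p, q⟫, hx p hp h]
    rw [inner_sub_left, h1] at h3
    nlinarith [hw0 p hp]
  have hsum := Finset.sum_le_sum hterm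
  rw [Finset.sum_sub_distrib, ← Finset.mul_sum, ← Finset.sum_mul, ← Finset.sum_mul, hw] at hsum
  have := mul_le_mul_of_nonneg_left hV (sq_nonneg a)
  linarith

/-- A finite `ρ`-net of the unit sphere of `E` that embeds into a space `F` of smaller dimension
by a `1`-Lipschitz map with `a`-Lipschitz inverse satisfies `1 - ρ ≤ a² ρ²`. -/
theorem one_sub_le_sq_mul_sq_of_finset [FiniteDimensional ℝ E] [FiniteDimensional ℝ F]
    (hdim : finrank ℝ F < finrank ℝ E) {s : Finset E} (hs : ∀ p ∈ s, ‖p‖ = 1) {φ : E → F}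
    {a ρ : ℝ} (ha : 0 < a) (hρ : 0 < ρ)
    (hnet : ∀ x : E, ‖x‖ = 1 → ∃ p ∈ s, ‖x - p‖ < ρ)
    (hlow : ∀ p ∈ s, ∀ q ∈ s, ‖p - q‖ ≤ a * ‖φ p - φ q‖)
    (hup : ∀ p ∈ s, ∀ q ∈ s, ‖φ p - φ q‖ ≤ ‖p - q‖) : 1 - ρ ≤ a ^ 2 * ρ ^ 2 := by
  by_contra! hlt
  obtain ⟨R, hR1, hR2⟩ : ∃ R, ρ ^ 2 < R ∧ a ^ 2 * (ρ ^ 2 + R) < 2 * (1 - ρ) := by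
    refine ⟨(1 - ρ) / a ^ 2, by rw [lt_div_iff₀ (by positivity)]; linarith, ?_⟩
    have : a ^ 2 * ((1 - ρ) / a ^ 2) = 1 - ρ := by field_simp
    linarith
  set w : E → E → ℝ := fun x p => Real.smoothTransition (ρ ^ 2 - ‖x - p‖ ^ 2) with hw
  have hw0 : ∀ x p, 0 ≤ w x p := fun x p => Real.smoothTransition.nonneg _
  have hwd : ∀ p, ContDiff ℝ 1 fun x => w x p := fun p =>
    Real.smoothTransition.contDiff.comp
      (contDiff_const.sub ((contDiff_id.sub contDiff_const).norm_sq ℝ))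
  set S : E → ℝ := fun x => ∑ p ∈ s, w x p with hS
  have hS0 : ∀ x, 0 ≤ S x := fun x => Finset.sum_nonneg fun p _ => hw0 x p
  have hS1 : ∀ x, ‖x‖ = 1 → 0 < S x := by
    intro x hx
    obtain ⟨p, hp, hxp⟩ := hnet x hx
    refine Finset.sum_pos' (fun p _ => hw0 x p) ⟨p, hp, Real.smoothTransition.pos_of_pos ?_⟩
    nlinarith [norm_nonneg (x - p)]
  have hden : ∀ x, S x + (1 - ‖x‖ ^ 2) ^ 2 ≠ 0 := by
    intro x
    rcases eq_or_ne ‖x‖ 1 with h | h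
    · have := hS1 x h
      positivity
    · have h1 : 1 - ‖x‖ ^ 2 ≠ 0 := fun h2 => h
        ((pow_eq_one_iff_of_nonneg (norm_nonneg x) two_ne_zero).1 (by linarith))
      have := hS0 x
      positivity
  set f : E → F := fun x => (S x + (1 - ‖x‖ ^ 2) ^ 2)⁻¹ • ∑ p ∈ s, w x p • φ p with hf
  have hfd : ContDiff ℝ 1 f := by
    refine ContDiff.smul (ContDiff.inv (ContDiff.add ?_ ?_) hden) ?_
    · exact ContDiff.sum fun p _ => hwd p
    · exact (contDiff_const.sub (contDiff_id.norm_sq ℝ)).pow 2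
    · exact ContDiff.sum fun p _ => (hwd p).smul contDiff_const
  set b : E → F → ℝ := fun q z => Real.smoothTransition (R - ‖z - φ q‖ ^ 2) with hb
  set h : F → E := fun z => ∑ q ∈ s, b q z • q with hh
  have hhd : ContDiff ℝ 1 h := ContDiff.sum fun q _ => ContDiff.smul
    (Real.smoothTransition.contDiff.comp
      (contDiff_const.sub ((contDiff_id.sub contDiff_const).norm_sq ℝ))) contDiff_const
  have hpos : ∀ x ∈ sphere (0 : E) 1, 0 < ⟪x, h (f x)⟫ := by
    intro x hx
    rw [mem_sphere_zero_iff_norm] at hx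
    have hSx := hS1 x hx
    set l : E → ℝ := fun p => (S x)⁻¹ * w x p with hl
    have hl0 : ∀ p ∈ s, 0 ≤ l p := fun p _ => mul_nonneg (inv_nonneg.2 hSx.le) (hw0 x p)
    have hl1 : ∑ p ∈ s, l p = 1 := by
      rw [← Finset.mul_sum]
      exact inv_mul_cancel₀ hSx.ne'
    have hlx : ∀ p ∈ s, l p ≠ 0 → ‖x - p‖ ≤ ρ := by
      intro p _ hp
      have h1 : w x p ≠ 0 := right_ne_zero_of_mul hp
      have h2 := mt Real.smoothTransition.zero_iff_nonpos.2 h1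
      nlinarith [norm_nonneg (x - p)]
    have hfx : f x = ∑ p ∈ s, l p • φ p := by
      simp [hf, hl, hx, Finset.smul_sum, mul_smul]
    have hinner : ∀ q ∈ s, ‖f x - φ q‖ ^ 2 < R → 0 < ⟪x, q⟫ := by
      intro q hq hqR
      rw [hfx] at hqR
      refine inner_pos_of_norm_sub_mean_lt hs hlow hup hl0 hl1 hlx hq (lt_of_le_of_lt ?_ hR2)
      gcongr
    obtain ⟨q, hq, hqR⟩ : ∃ q ∈ s, ‖f x - φ q‖ ^ 2 < R := by
      by_contra! hge
      have h1 := sum_mul_norm_sub_mean_sq_le s l hl0 hl1 id φ hup x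
      have h2 : R ≤ ∑ p ∈ s, l p * ‖φ p - ∑ j ∈ s, l j • φ j‖ ^ 2 := by
        rw [← one_mul R, ← hl1, Finset.sum_mul]
        refine Finset.sum_le_sum fun p hp => mul_le_mul_of_nonneg_left ?_ (hl0 p hp)
        rw [← hfx, norm_sub_rev]
        exact hge p hp
      have h3 : ∑ p ∈ s, l p * ‖id p - x‖ ^ 2 ≤ ρ ^ 2 := by
        rw [← one_mul (ρ ^ 2), ← hl1, Finset.sum_mul]
        refine Finset.sum_le_sum fun p hp => ?_
        rcases eq_or_ne (l p) 0 with h | h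
        · simp [h]
        · have := hl0 p hp
          rw [id, norm_sub_rev]
          gcongr
          exact hlx p hp h
      linarith
    simp only [hh, inner_sum, inner_smul_right]
    refine Finset.sum_pos' (fun p hp => ?_) ⟨q, hq, mul_pos
      (Real.smoothTransition.pos_of_pos (by linarith)) (hinner q hq hqR)⟩
    rcases le_or_gt R (‖f x - φ p‖ ^ 2) with h | h
    · simp [hb, Real.smoothTransition.zero_of_nonpos (sub_nonpos.2 h)]
    · exact mul_nonneg (Real.smoothTransition.nonneg _) (hinner p hp h).le
  have hcomp : ContDiff ℝ 1 fun x => h (f x) := hhd.comp hfd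
  obtain ⟨m, hm0, hm⟩ := (isCompact_sphere (0 : E) 1).exists_forall_le'
    (continuous_id.inner hcomp.continuous).continuousOn hpos
  obtain ⟨c, hc, hcm⟩ := (hhd.dense_compl_range_of_finrank_lt_finrank hdim).exists_dist_lt 0 hm0
  obtain ⟨x, hx⟩ := exists_eq_zero_of_inner_pos (hcomp.sub (contDiff_const (c := c))) (by
    intro x hx
    have h1 := hm x hx
    have h2 := real_inner_le_norm x c
    rw [mem_sphere_zero_iff_norm.1 hx, one_mul] at h2
    rw [dist_zero_left] at hcm
    rw [inner_sub_right]
    simp only [id] at h1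
    linarith)
  exact hc ⟨f x, sub_eq_zero.1 hx⟩

end

theorem stmt16 (k : ℕ) (hk : 1 ≤ k) (η : ℝ) (hη0 : 0 < η) (hη : η ≤ 0.1)
    (P : Set (EuclideanSpace ℝ (Fin (k + 1))))
    (hPsphere : ∀ p ∈ P, ‖p‖ = 1)
    (hnet : ∀ x : EuclideanSpace ℝ (Fin (k + 1)), ‖x‖ = 1 → ∃ p ∈ P, ‖x - p‖ ≤ η)
    (φ : EuclideanSpace ℝ (Fin (k + 1)) → EuclideanSpace ℝ (Fin k))
    (a : ℝ) (ha : 1 ≤ a)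
    (hlow : ∀ x ∈ P, ∀ y ∈ P, ‖x - y‖ / a ≤ ‖φ x - φ y‖)
    (hup : ∀ x ∈ P, ∀ y ∈ P, ‖φ x - φ y‖ ≤ ‖x - y‖) :
    (1 - η) / η ≤ a := by
  have ha0 : 0 < a := by linarith
  obtain ⟨ρ, hρ⟩ : ∃ ρ, ρ = η + η ^ 2 / 4 := ⟨_, rfl⟩
  have hηρ : η < ρ := by rw [hρ]; linarith [pow_pos hη0 2]
  obtain ⟨t, htP, htfin, ht⟩ := (isCompact_sphere
    (0 : EuclideanSpace ℝ (Fin (k + 1))) 1).elim_finite_subcover_image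
    (b := P) (c := fun p => ball p ρ) (fun _ _ => isOpen_ball) (by
      intro x hx
      obtain ⟨p, hp, hxp⟩ := hnet x (by simpa using hx)
      exact mem_biUnion hp (by rw [mem_ball_iff_norm]; linarith))
  have key := one_sub_le_sq_mul_sq_of_finset (s := htfin.toFinset) (φ := φ) (a := a) (ρ := ρ)
    (by simp) (fun p hp => hPsphere p (htP (htfin.mem_toFinset.1 hp))) ha0 (by linarith)
    (by
      intro x hx
      obtain ⟨p, hp, hxp⟩ := mem_iUnion₂.1 (ht (show x ∈ sphere 0 1 by simpa using hx))
      exact ⟨p, by simpa using hp, by simpa [dist_eq_norm] using hxp⟩)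
    (by
      intro p hp q hq
      have := hlow p (htP (htfin.mem_toFinset.1 hp)) q (htP (htfin.mem_toFinset.1 hq))
      rwa [div_le_iff₀' ha0] at this)
    (fun p hp q hq => hup p (htP (htfin.mem_toFinset.1 hp)) q (htP (htfin.mem_toFinset.1 hq)))
  by_contra! hlt
  rw [lt_div_iff₀ hη0] at hlt
  have h1 : a * ρ < (1 - η) * (1 + η / 4) := by
    have : a * ρ = a * η * (1 + η / 4) := by rw [hρ]; ring
    rw [this]
    gcongr
  have h2 : a ^ 2 * ρ ^ 2 < ((1 - η) * (1 + η / 4)) ^ 2 := by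
    rw [← mul_pow]
    have : 0 < ρ := by linarith
    gcongr
  norm_num at hη
  have h3 : ((1 - η) * (1 + η / 4)) ^ 2 ≤ 1 - ρ := by
    rw [hρ]
    nlinarith [mul_pos hη0 hη0, mul_pos (mul_pos hη0 hη0) hη0]
  linarith
end

section
/- Let (P,ν) be a finite metric space with at least two points, (M,ρ) any metric space, f : P → M a map, and 0 < ε < 1/2. Let (A_i, B_i), 1 ≤ i ≤ s, be pairs of nonempty subsets of P such that: A_i ∩ B_i = ∅ for every i; for every pair of distinct x, y ∈ P there is i with (x ∈ A_i and y ∈ B_i) or (x ∈ B_i and y ∈ A_i); and ν(A_i, B_i) ≥ ε^{−1}·max(diam A_i, diam B_i) for every i. For each i let a_i ∈ A_i and b_i ∈ B_i be arbitrary points. Let L = max_{x ≠ y ∈ P} ρ(f(x), f(y))/ν(x,y) be the Lipschitz constant of f, and let K = max_{1 ≤ i ≤ s} ρ(f(a_i), f(b_i))/ν(a_i, b_i). Then ((1−2ε)/(1+2ε))·L ≤ K ≤ L. -/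
/-- If `f` is `L`-Lipschitz and expands the single pair `u, v` by at most `K`, then it expands a
pair `x, y` with `x` close to `u` and `y` close to `v` by at most `2 * ε * L + (1 + 2 * ε) * K`. -/
lemma dist_map_le_of_dist_le_mul {P M : Type*} [PseudoMetricSpace P] [PseudoMetricSpace M]
    {f : P → M} {ε L K : ℝ} {x y u v : P} (hL : 0 ≤ L) (hK : 0 ≤ K)
    (hf : ∀ p q, dist (f p) (f q) ≤ L * dist p q)
    (huv : dist (f u) (f v) ≤ K * dist u v)
    (hxu : dist x u ≤ ε * dist x y) (hvy : dist v y ≤ ε * dist x y) :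
    dist (f x) (f y) ≤ (2 * ε * L + (1 + 2 * ε) * K) * dist x y := by
  have hd : dist u v ≤ (1 + 2 * ε) * dist x y := by
    have h := dist_triangle4 u x y v
    rw [dist_comm u x, dist_comm y v] at h
    linarith
  calc dist (f x) (f y) ≤ dist (f x) (f u) + dist (f u) (f v) + dist (f v) (f y) :=
        dist_triangle4 _ _ _ _
    _ ≤ L * (ε * dist x y) + K * ((1 + 2 * ε) * dist x y) + L * (ε * dist x y) := by
        gcongr
        · exact (hf x u).trans (by gcongr)
        · exact huv.trans (by gcongr)
        · exact (hf v y).trans (by gcongr)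
    _ = _ := by ring

theorem stmt18 {P : Type*} [MetricSpace P] [Fintype P] {M : Type*} [MetricSpace M]
    (hcard : 2 ≤ Fintype.card P) (f : P → M)
    (ε : ℝ) (hε0 : 0 < ε) (hε : ε < 1 / 2)
    (s : ℕ) (A B : Fin s → Finset P) (a b : Fin s → P)
    (hA : ∀ i, (A i).Nonempty) (hB : ∀ i, (B i).Nonempty)
    (hdisj : ∀ i, Disjoint (A i) (B i))
    (hcover : ∀ x y : P, x ≠ y → ∃ i, (x ∈ A i ∧ y ∈ B i) ∨ (x ∈ B i ∧ y ∈ A i))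
    (hsep : ∀ i, ∀ p ∈ A i, ∀ q ∈ B i,
      ε⁻¹ * max (Metric.diam ((A i : Finset P) : Set P))
          (Metric.diam ((B i : Finset P) : Set P)) ≤ dist p q)
    (ha : ∀ i, a i ∈ A i) (hb : ∀ i, b i ∈ B i)
    (L K : ℝ)
    (hL : IsGreatest {c : ℝ | ∃ x y : P, x ≠ y ∧ c = dist (f x) (f y) / dist x y} L)
    (hK : IsGreatest {c : ℝ | ∃ i : Fin s, c = dist (f (a i)) (f (b i)) / dist (a i) (b i)} K) :
    (1 - 2 * ε) / (1 + 2 * ε) * L ≤ K ∧ K ≤ L := by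
  have hab : ∀ i, a i ≠ b i := fun i e =>
    Finset.disjoint_left.mp (hdisj i) (ha i) (e ▸ hb i)
  obtain ⟨⟨x₀, y₀, hxy₀, hL₀⟩, hLub⟩ := hL
  obtain ⟨⟨i₀, hK₀⟩, hKub⟩ := hK
  have hL_nonneg : 0 ≤ L := hL₀ ▸ by positivity
  have hK_nonneg : 0 ≤ K := hK₀ ▸ by positivity
  refine ⟨?_, hLub ⟨_, _, hab i₀, hK₀⟩⟩
  have hf : ∀ p q, dist (f p) (f q) ≤ L * dist p q := by
    intro p q
    rcases eq_or_ne p q with rfl | hpq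
    · simp
    · exact (div_le_iff₀ (dist_pos.mpr hpq)).mp (hLub ⟨p, q, hpq, rfl⟩)
  have hfab : ∀ i, dist (f (a i)) (f (b i)) ≤ K * dist (a i) (b i) := fun i =>
    (div_le_iff₀ (dist_pos.mpr (hab i))).mp (hKub ⟨i, rfl⟩)
  have key : ∀ i, ∀ x ∈ A i, ∀ y ∈ B i,
      dist (f x) (f y) ≤ (2 * ε * L + (1 + 2 * ε) * K) * dist x y := by
    intro i x hx y hy
    have hs := (inv_mul_le_iff₀ hε0).mp (hsep i x hx y hy)
    refine dist_map_le_of_dist_le_mul hL_nonneg hK_nonneg hf (hfab i) ?_ ?_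
    · exact (Metric.dist_le_diam_of_mem (A i).finite_toSet.isBounded hx (ha i)).trans
        ((le_max_left _ _).trans hs)
    · exact (Metric.dist_le_diam_of_mem (B i).finite_toSet.isBounded (hb i) hy).trans
        ((le_max_right _ _).trans hs)
  have hLK : L ≤ 2 * ε * L + (1 + 2 * ε) * K := by
    rw [hL₀, div_le_iff₀ (dist_pos.mpr hxy₀), ← hL₀]
    obtain ⟨i, ⟨hx, hy⟩ | ⟨hx, hy⟩⟩ := hcover x₀ y₀ hxy₀
    · exact key i x₀ hx y₀ hy
    · rw [dist_comm (f x₀), dist_comm x₀]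
      exact key i y₀ hy x₀ hx
  rw [div_mul_eq_mul_div, div_le_iff₀ (by positivity)]
  linarith
end
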